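/- Let (R, 𝔪) be a commutative Noetherian local ring and M a finitely generated R-module of dimension d with dimension filtration D_0 ⊂ D_1 ⊂ ⋯ ⊂ D_t = M; set 𝒟_0 = D_0 and 𝒟_i = D_i/D_{i−1} for i = 1, …, t, and d_i = dim D_i. Then the following are equivalent: (i) M is sequentially Cohen-Macaulay; (ii) for every good parameter ideal q of M, ℓ(M/q^{n+1}M) = Σ_{i=0}^{t} C(n+d_i, d_i)·ℓ(𝒟_i/q𝒟_i) for all n ≥ 0; (iii) there exists a good parameter ideal q of M such that ℓ(M/q^{n+1}M) = Σ_{i=0}^{t} C(n+d_i, d_i)·ℓ(𝒟_i/q𝒟_i) for all n ≥ 0. -/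

import Mathlib

open IsLocalRing

/-- The Krull dimension of a module, `dim M = dim R/ann M`. -/
noncomputable def moduleDim (R : Type*) [CommRing R] (M : Type*) [AddCommGroup M]
    [Module R M] : WithBot ℕ∞ :=
  ringKrullDim (R ⧸ Module.annihilator R M)

/-- The length of a module, as the Krull dimension of its lattice of submodules. -/
noncomputable def moduleLength (R : Type*) [CommRing R] (M : Type*) [AddCommGroup M]
    [Module R M] : WithBot ℕ∞ :=
  Order.krullDim (Submodule R M)

/-- The depth of a module over a local ring: the supremum of lengths of `M`-regular
sequences consisting of elements of the maximal ideal. -/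
noncomputable def moduleDepth (R : Type*) [CommRing R] [IsLocalRing R] (M : Type*)
    [AddCommGroup M] [Module R M] : ℕ∞ :=
  sSup {n : ℕ∞ | ∃ rs : List R, (rs.length : ℕ∞) = n ∧ (∀ r ∈ rs, r ∈ maximalIdeal R) ∧
    RingTheory.Sequence.IsRegular M rs}

/-- A module over a Noetherian local ring is Cohen-Macaulay if its depth equals its
Krull dimension. -/
def IsCM (R : Type*) [CommRing R] [IsLocalRing R] (M : Type*) [AddCommGroup M]
    [Module R M] : Prop :=
  (moduleDepth R M : WithBot ℕ∞) = moduleDim R M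

/-- The zeroth local cohomology `H^0_𝔪(M)`: the submodule of elements annihilated by
some power of the maximal ideal. -/
noncomputable def H0m (R : Type*) [CommRing R] [IsLocalRing R] (M : Type*) [AddCommGroup M]
    [Module R M] : Submodule R M :=
  ⨆ n : ℕ, Submodule.torsionBySet R M ((maximalIdeal R ^ n : Ideal R) : Set R)

/-- `x : Fin d → R` is a system of parameters of `M` (where `d = dim M`):
all `x i` lie in the maximal ideal and `M/(x₁,…,x_d)M` has finite length. -/
def IsSOP (R : Type*) [CommRing R] [IsLocalRing R] (M : Type*) [AddCommGroup M] [Module R M]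
    {d : ℕ} (x : Fin d → R) : Prop :=
  (∀ i, x i ∈ maximalIdeal R) ∧
    IsFiniteLength R (M ⧸ (Ideal.span (Set.range x) • (⊤ : Submodule R M)))

/-- `Λ_{s,n}`: tuples of positive integers of size `s` summing to `s + n - 1`. -/
def Lambda (s n : ℕ) : Set (Fin s → ℕ) :=
  {α | (∀ i, 1 ≤ α i) ∧ (∑ i, α i) = s + n - 1}

/-- The sequence `x` has the property of parametric decomposition:
`q^n M = ⋂_{α ∈ Λ_{d,n}} (x₁^{α₁},…,x_d^{α_d})M` for all `n ≥ 1`, where `q = (x₁,…,x_d)`. -/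
def HasParamDecomp (R : Type*) [CommRing R] (M : Type*) [AddCommGroup M] [Module R M]
    {d : ℕ} (x : Fin d → R) : Prop :=
  ∀ n : ℕ, 1 ≤ n →
    (Ideal.span (Set.range x)) ^ n • (⊤ : Submodule R M) =
      ⨅ α ∈ Lambda d n, Ideal.span (Set.range fun i => x i ^ α i) • (⊤ : Submodule R M)

/-- `D : Fin (t+1) → Submodule R M` is the dimension filtration of `M`:
`D 0 = H^0_𝔪(M)`, `D t = M`, and each `D i` is the largest submodule of `D (i+1)` of
strictly smaller dimension. -/
def IsDimFiltration (R : Type*) [CommRing R] [IsLocalRing R] (M : Type*) [AddCommGroup M]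
    [Module R M] {t : ℕ} (D : Fin (t + 1) → Submodule R M) : Prop :=
  D 0 = H0m R M ∧ D (Fin.last t) = ⊤ ∧
    ∀ i : Fin t,
      D i.castSucc ≤ D i.succ ∧
      moduleDim R ↥(D i.castSucc) < moduleDim R ↥(D i.succ) ∧
      ∀ N : Submodule R M, N ≤ D i.succ →
        moduleDim R ↥N < moduleDim R ↥(D i.succ) → N ≤ D i.castSucc

/-- Given the dimension filtration `D` with `d_i = ds i`, a system of parameters
`x₁,…,x_d` is good if `D_i ∩ (x_{d_i+1},…,x_d)M = 0` for all `i < t`. -/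
def IsGoodSOP (R : Type*) [CommRing R] [IsLocalRing R] (M : Type*) [AddCommGroup M]
    [Module R M] {d t : ℕ} (D : Fin (t + 1) → Submodule R M) (ds : Fin (t + 1) → ℕ)
    (x : Fin d → R) : Prop :=
  IsSOP R M x ∧
    ∀ i : Fin (t + 1), (i : ℕ) < t →
      D i ⊓ (Ideal.span {r : R | ∃ j : Fin d, ds i ≤ (j : ℕ) ∧ r = x j}) •
        (⊤ : Submodule R M) = ⊥

/-- The predecessor submodule in a filtration: `⊥` for `i = 0`, else `D (i-1)`. -/
def predD {R : Type*} [CommRing R] {M : Type*} [AddCommGroup M] [Module R M]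
    {t : ℕ} (D : Fin (t + 1) → Submodule R M) (i : Fin (t + 1)) : Submodule R M :=
  if h : (i : ℕ) = 0 then ⊥ else D ⟨(i : ℕ) - 1, by omega⟩

namespace SCM

open IsLocalRing

variable {R : Type*} [CommRing R] {M : Type*} [AddCommGroup M] [Module R M]

lemma mem_span_smul {y : R} {N : Submodule R M} {u : M} :
    u ∈ Ideal.span {y} • N ↔ ∃ v ∈ N, y • v = u := by
  rw [Submodule.ideal_span_singleton_smul, Submodule.mem_smul_pointwise_iff_exists]

/-- `y` is a nonzerodivisor on `M / D`. -/
def Reg (D : Submodule R M) (y : R) : Prop := ∀ m : M, y • m ∈ D → m ∈ D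

/-- `l` is a weakly regular sequence on `M / D`. -/
def RegOn : List R → Submodule R M → Prop
  | [], _ => True
  | y :: l, D => Reg D y ∧ RegOn l (D ⊔ Ideal.span {y} • ⊤)

/-- Splitting a power of `q = (y) + J`. -/
lemma pow_succ_split (y : R) (J : Ideal R) (n : ℕ) :
    (Ideal.span {y} ⊔ J) ^ (n + 1) = J ^ (n + 1) ⊔ Ideal.span {y} * (Ideal.span {y} ⊔ J) ^ n := by
  apply le_antisymm
  · induction n with
    | zero => simp [sup_comm]
    | succ n ih =>
      conv_lhs => rw [pow_succ]
      refine (Ideal.mul_mono_left ih).trans ?_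
      rw [Ideal.sup_mul, Ideal.mul_sup]
      refine sup_le (sup_le ?_ ?_) ?_
      · refine le_sup_of_le_right ?_
        rw [mul_comm]
        exact Ideal.mul_mono_right (Ideal.pow_right_mono le_sup_right _)
      · rw [← pow_succ]; exact le_sup_left
      · rw [mul_assoc, ← pow_succ]; exact le_sup_right
  · refine sup_le (Ideal.pow_right_mono le_sup_right _) ?_
    rw [pow_succ']
    exact Ideal.mul_mono_left le_sup_left

theorem T_lemma (l : List R) : ∀ (D : Submodule R M), RegOn l D → ∀ n : ℕ,
    D ⊓ (Ideal.ofList l) ^ n • ⊤ ≤ (Ideal.ofList l) ^ n • D := by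
  induction l with
  | nil =>
    intro D _ n
    cases n with
    | zero => simp
    | succ n => simp
  | cons y l ih =>
    intro D h n
    obtain ⟨hy, hl⟩ := h
    rw [Ideal.ofList_cons]
    induction n with
    | zero => simp
    | succ n ihn =>
      rintro u ⟨huD, hu⟩
      have hu' : u ∈ (Ideal.ofList l ^ (n + 1) ⊔ Ideal.span {y} *
        (Ideal.span {y} ⊔ Ideal.ofList l) ^ n) • (⊤ : Submodule R M) := by
        rw [← pow_succ_split]; exact hu
      rw [Submodule.sup_smul, Submodule.mul_smul] at hu'
      obtain ⟨a, ha, b', hb', rfl⟩ := Submodule.mem_sup.1 hu'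
      obtain ⟨b, hb, rfl⟩ := mem_span_smul.1 hb'
      have ha2 : a ∈ Ideal.ofList l ^ (n + 1) • (D ⊔ Ideal.span {y} • (⊤ : Submodule R M)) := by
        apply ih _ hl
        refine ⟨?_, ha⟩
        have : a = (a + y • b) - y • b := by abel
        rw [this]
        refine Submodule.sub_mem _ (Submodule.mem_sup_left huD)
          (Submodule.mem_sup_right (mem_span_smul.2 ⟨b, trivial, rfl⟩))
      rw [Submodule.smul_sup, ← Submodule.mul_smul, mul_comm, Submodule.mul_smul] at ha2
      obtain ⟨a1, ha1, c', hc', rfl⟩ := Submodule.mem_sup.1 ha2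
      obtain ⟨c, hc, rfl⟩ := mem_span_smul.1 hc'
      have hle : Ideal.ofList l ^ (n + 1) ≤ (Ideal.span {y} ⊔ Ideal.ofList l) ^ n :=
        (Ideal.pow_le_pow_right (Nat.le_succ n)).trans (Ideal.pow_right_mono le_sup_right _)
      have hle2 : Ideal.ofList l ^ (n + 1) ≤ (Ideal.span {y} ⊔ Ideal.ofList l) ^ (n + 1) :=
        (Ideal.pow_right_mono le_sup_right _)
      have hbc : b + c ∈ D ⊓ (Ideal.span {y} ⊔ Ideal.ofList l) ^ n • (⊤ : Submodule R M) := by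
        constructor
        · apply hy
          have : y • (b + c) = (a1 + y • c + y • b) - a1 := by rw [smul_add]; abel
          rw [this]
          exact Submodule.sub_mem _ huD (Submodule.smul_le_right ha1)
        · exact Submodule.add_mem _ hb (Submodule.smul_mono_left hle hc)
      have := ihn hbc
      have e : a1 + y • c + y • b = a1 + y • (b + c) := by rw [smul_add]; abel
      rw [e]
      refine Submodule.add_mem _ (Submodule.smul_mono_left hle2 ha1) ?_
      rw [pow_succ', Submodule.mul_smul]
      exact Submodule.smul_mem_smul (Ideal.mem_sup_left (Ideal.mem_span_singleton_self y)) this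

/-! ### Lengths -/

/-- colength bound step -/
lemma colon_of_regOn (y : R) (l : List R) (D : Submodule R M) (h : RegOn (y :: l) D) (n : ℕ)
    (v : M) (hv : y • v ∈ D ⊔ (Ideal.ofList (y :: l)) ^ (n + 1) • ⊤) :
    v ∈ D ⊔ (Ideal.ofList (y :: l)) ^ n • ⊤ := by
  obtain ⟨hy, hl⟩ := h
  rw [Ideal.ofList_cons] at *
  rw [pow_succ_split, Submodule.sup_smul, Submodule.mul_smul] at hv
  obtain ⟨δ, hδ, w, hw, hvw⟩ := Submodule.mem_sup.1 hv
  obtain ⟨a, ha, b', hb', rfl⟩ := Submodule.mem_sup.1 hw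
  obtain ⟨b, hb, rfl⟩ := mem_span_smul.1 hb'
  have ha2 : a ∈ Ideal.ofList l ^ (n + 1) • (D ⊔ Ideal.span {y} • (⊤ : Submodule R M)) := by
    apply T_lemma l _ hl
    refine ⟨?_, ha⟩
    have : a = -δ + y • (v - b) := by rw [smul_sub, ← hvw]; abel
    rw [this]
    exact Submodule.add_mem _ (Submodule.mem_sup_left (D.neg_mem hδ))
      (Submodule.mem_sup_right (mem_span_smul.2 ⟨_, trivial, rfl⟩))
  rw [Submodule.smul_sup, ← Submodule.mul_smul, mul_comm, Submodule.mul_smul] at ha2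
  obtain ⟨a1, ha1, c', hc', rfl⟩ := Submodule.mem_sup.1 ha2
  obtain ⟨c, hc, rfl⟩ := mem_span_smul.1 hc'
  have hle : Ideal.ofList l ^ (n + 1) ≤ (Ideal.span {y} ⊔ Ideal.ofList l) ^ n :=
    (Ideal.pow_le_pow_right (Nat.le_succ n)).trans (Ideal.pow_right_mono le_sup_right _)
  have hD : v - b - c ∈ D := by
    apply hy
    have : y • (v - b - c) = δ + a1 := by rw [smul_sub, smul_sub, ← hvw]; abel
    rw [this]
    exact D.add_mem hδ (Submodule.smul_le_right ha1)
  have : v = (v - b - c) + (b + c) := by abel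
  rw [this]
  exact Submodule.add_mem _ (Submodule.mem_sup_left hD) (Submodule.mem_sup_right
    (Submodule.add_mem _ hb (Submodule.smul_mono_left hle hc)))

/-- `ℓ(M/A)` split by multiplication by `y`. -/
lemma length_mul (y : R) (A B : Submodule R M) (hAB : ∀ a ∈ A, y • a ∈ B) :
    Module.length R (M ⧸ B) ≤ Module.length R (M ⧸ A) +
      Module.length R (M ⧸ (B ⊔ Ideal.span {y} • ⊤)) ∧
    ((∀ v, y • v ∈ B → v ∈ A) → Module.length R (M ⧸ B) = Module.length R (M ⧸ A) +
      Module.length R (M ⧸ (B ⊔ Ideal.span {y} • ⊤))) ∧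
    (Module.length R (M ⧸ B) = Module.length R (M ⧸ A) +
      Module.length R (M ⧸ (B ⊔ Ideal.span {y} • ⊤)) → Module.length R (M ⧸ B) ≠ ⊤ →
      ∀ v, y • v ∈ B → v ∈ A) := by
  let f : (M ⧸ A) →ₗ[R] (M ⧸ B) := A.mapQ B (LinearMap.lsmul R M y) (fun a ha => hAB a ha)
  let g : (M ⧸ B) →ₗ[R] (M ⧸ (B ⊔ Ideal.span {y} • ⊤)) := Submodule.factor le_sup_left
  have hg : Function.Surjective g := Submodule.factor_surjective _
  have hfapp : ∀ v : M, f (Submodule.Quotient.mk v) = Submodule.Quotient.mk (y • v) := fun v => rfl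
  have hgapp : ∀ v : M, g (Submodule.Quotient.mk v) = Submodule.Quotient.mk v := fun v => rfl
  have hex : Function.Exact (LinearMap.range f).subtype g := by
    intro u
    obtain ⟨u, rfl⟩ := Submodule.Quotient.mk_surjective _ u
    rw [hgapp, Submodule.Quotient.mk_eq_zero]
    constructor
    · intro h
      obtain ⟨b, hb, w, hw, rfl⟩ := Submodule.mem_sup.1 h
      obtain ⟨v, -, rfl⟩ := mem_span_smul.1 hw
      refine ⟨⟨f (Submodule.Quotient.mk v), LinearMap.mem_range_self _ _⟩, ?_⟩
      simp only [Submodule.subtype_apply]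
      rw [hfapp, Submodule.Quotient.mk_add, (Submodule.Quotient.mk_eq_zero B).2 hb, zero_add]
    · rintro ⟨⟨w, v, rfl⟩, h⟩
      obtain ⟨v, rfl⟩ := Submodule.Quotient.mk_surjective _ v
      simp only [Submodule.subtype_apply] at h
      rw [hfapp, Submodule.Quotient.eq] at h
      have : u = -(y • v - u) + y • v := by abel
      rw [this]
      exact Submodule.add_mem _ (Submodule.mem_sup_left (B.neg_mem h))
        (Submodule.mem_sup_right (mem_span_smul.2 ⟨_, trivial, rfl⟩))
  have h1 := Module.length_eq_add_of_exact _ g (Submodule.subtype_injective _) hg hex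
  have h2 := Module.length_eq_add_of_exact (LinearMap.ker f).subtype f.rangeRestrict
    (Submodule.subtype_injective _) f.surjective_rangeRestrict (by
      intro u; simp [Subtype.ext_iff])
  have hinj : (∀ v, y • v ∈ B → v ∈ A) ↔ LinearMap.ker f = ⊥ := by
    rw [LinearMap.ker_eq_bot']
    constructor
    · intro h u hu
      obtain ⟨u, rfl⟩ := Submodule.Quotient.mk_surjective _ u
      rw [hfapp, Submodule.Quotient.mk_eq_zero] at hu
      rw [Submodule.Quotient.mk_eq_zero]
      exact h _ hu
    · intro h v hv
      rw [← Submodule.Quotient.mk_eq_zero]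
      apply h
      rw [hfapp, Submodule.Quotient.mk_eq_zero]
      exact hv
  refine ⟨?_, ?_, ?_⟩
  · rw [h1, h2]
    gcongr
    exact le_add_self
  · intro h
    rw [hinj] at h
    have : Module.length R (LinearMap.ker f) = 0 := by rw [h]; exact Module.length_bot
    rw [h1, h2, this, zero_add]
  · intro h hne
    rw [hinj, ← Submodule.subsingleton_iff_eq_bot, ← Module.length_eq_zero_iff (R := R)]
    rw [h1] at h hne
    rw [h2] at h
    generalize Module.length R (LinearMap.ker f) = a at *
    generalize Module.length R (LinearMap.range f) = b at *
    generalize Module.length R (M ⧸ (B ⊔ Ideal.span {y} • ⊤)) = c at *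
    have hb : b ≠ ⊤ := fun hb => hne (by simp [hb])
    have hc : c ≠ ⊤ := fun hb => hne (by simp [hb])
    lift b to ℕ using hb
    lift c to ℕ using hc
    induction a using ENat.recTopCoe with
    | top =>
      rw [top_add, top_add] at h
      exact absurd h (by exact_mod_cast ENat.natCast_ne_top (b + c))
    | coe a =>
      norm_cast at h ⊢
      omega

/-- The colength function `n ↦ ℓ(M / (D + q^(n+1) M))`. -/
noncomputable def F (l : List R) (D : Submodule R M) (n : ℕ) : ℕ∞ :=
  Module.length R (M ⧸ (D ⊔ (Ideal.ofList l) ^ (n + 1) • ⊤))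

lemma F_eq_aux (y : R) (l : List R) (D : Submodule R M) (n : ℕ) :
    D ⊔ Ideal.ofList (y :: l) ^ (n + 1) • ⊤ ⊔ Ideal.span {y} • (⊤ : Submodule R M) =
      (D ⊔ Ideal.span {y} • (⊤ : Submodule R M)) ⊔ Ideal.ofList l ^ (n + 1) • ⊤ := by
  rw [Ideal.ofList_cons, pow_succ_split, Submodule.sup_smul]
  apply le_antisymm
  · refine sup_le (sup_le (le_sup_of_le_left le_sup_left) (sup_le le_sup_right ?_))
      (le_sup_of_le_left le_sup_right)
    rw [Submodule.mul_smul]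
    exact le_sup_of_le_left (le_sup_of_le_right (Submodule.smul_mono le_rfl le_top))
  · refine sup_le (sup_le (le_sup_of_le_left le_sup_left) le_sup_right)
      (le_sup_of_le_left (le_sup_of_le_right le_sup_left))

lemma F_zero (y : R) (l : List R) (D : Submodule R M) :
    F (y :: l) D 0 = F l (D ⊔ Ideal.span {y} • ⊤) 0 := by
  have : D ⊔ Ideal.ofList (y :: l) ^ (0 + 1) • (⊤ : Submodule R M) =
      D ⊔ Ideal.ofList (y :: l) ^ (0 + 1) • ⊤ ⊔ Ideal.span {y} • ⊤ := by
    rw [Ideal.ofList_cons, zero_add, pow_one, Submodule.sup_smul]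
    exact le_antisymm le_sup_left (sup_le le_rfl (le_sup_of_le_right le_sup_left))
  unfold F
  rw [← F_eq_aux, ← this]

lemma F_nil (D : Submodule R M) (n : ℕ) : F [] D n = F [] D 0 := by
  have : ∀ n, D ⊔ Ideal.ofList ([] : List R) ^ (n + 1) • (⊤ : Submodule R M) = D := by
    intro n
    rw [Ideal.ofList_nil, ← Ideal.zero_eq_bot, zero_pow (Nat.succ_ne_zero n), Ideal.zero_eq_bot,
      Submodule.bot_smul, sup_bot_eq]
  unfold F
  rw [this, this]

lemma F_step (y : R) (l : List R) (D : Submodule R M) (n : ℕ) :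
    F (y :: l) D (n + 1) ≤ F (y :: l) D n + F l (D ⊔ Ideal.span {y} • ⊤) (n + 1) ∧
    (RegOn (y :: l) D →
      F (y :: l) D (n + 1) = F (y :: l) D n + F l (D ⊔ Ideal.span {y} • ⊤) (n + 1)) ∧
    (F (y :: l) D (n + 1) = F (y :: l) D n + F l (D ⊔ Ideal.span {y} • ⊤) (n + 1) →
      F (y :: l) D (n + 1) ≠ ⊤ →
      ∀ v, y • v ∈ D ⊔ (Ideal.ofList (y :: l)) ^ (n + 2) • ⊤ →
        v ∈ D ⊔ (Ideal.ofList (y :: l)) ^ (n + 1) • ⊤) := by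
  have hAB : ∀ a ∈ D ⊔ (Ideal.ofList (y :: l)) ^ (n + 1) • (⊤ : Submodule R M),
      y • a ∈ D ⊔ (Ideal.ofList (y :: l)) ^ (n + 2) • (⊤ : Submodule R M) := by
    intro a ha
    obtain ⟨u, hu, w, hw, rfl⟩ := Submodule.mem_sup.1 ha
    rw [smul_add]
    refine Submodule.add_mem _ (Submodule.mem_sup_left (D.smul_mem _ hu))
      (Submodule.mem_sup_right ?_)
    rw [pow_succ', Submodule.mul_smul]
    refine Submodule.smul_mem_smul ?_ hw
    rw [Ideal.ofList_cons]
    exact (Ideal.mem_sup_left (Ideal.mem_span_singleton_self y))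
  have h := length_mul y _ _ hAB
  rw [F_eq_aux] at h
  exact ⟨h.1, fun hr => h.2.1 (fun v => colon_of_regOn y l D hr (n + 1) v), h.2.2⟩

lemma choose_step (n e : ℕ) : (n + 1 + (e + 1)).choose (e + 1) =
    (n + (e + 1)).choose (e + 1) + (n + 1 + e).choose e := by
  have : n + 1 + (e + 1) = (n + 1 + e) + 1 := by ring
  rw [this, Nat.choose_succ_succ, add_comm]
  congr 2
  ring

theorem F_le (l : List R) : ∀ (D : Submodule R M) (n : ℕ),
    F l D n ≤ ((n + l.length).choose l.length : ℕ) * F l D 0 := by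
  induction l with
  | nil => intro D n; simp [F_nil D n]
  | cons y l ih =>
    intro D n
    induction n with
    | zero => simp
    | succ n ihn =>
      refine (F_step y l D n).1.trans ?_
      rw [List.length_cons, choose_step, Nat.cast_add, add_mul]
      refine add_le_add ihn ?_
      rw [F_zero]
      exact ih _ _

theorem F_eq (l : List R) : ∀ (D : Submodule R M) (_ : RegOn l D) (n : ℕ),
    F l D n = ((n + l.length).choose l.length : ℕ) * F l D 0 := by
  induction l with
  | nil => intro D _ n; simp [F_nil D n]
  | cons y l ih =>
    intro D h n
    induction n with
    | zero => simp
    | succ n ihn =>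
      refine ((F_step y l D n).2.1 h).trans ?_
      rw [List.length_cons, choose_step, Nat.cast_add, add_mul, ihn]
      congr 1
      rw [F_zero]
      exact ih _ h.2 _

end SCM

set_option linter.unusedSectionVars false

namespace SCM

open IsLocalRing

variable {R : Type*} [CommRing R] [IsLocalRing R] [IsNoetherianRing R]
  {M : Type*} [AddCommGroup M] [Module R M] [Module.Finite R M]

/-- Krull intersection modulo `D`. -/
lemma krull_inter (D : Submodule R M) (I : Ideal R) (hI : I ≤ maximalIdeal R) (v : M)
    (h : ∀ n : ℕ, v ∈ D ⊔ I ^ (n + 1) • ⊤) : v ∈ D := by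
  have hI' : I ≠ ⊤ := fun h => (maximalIdeal.isMaximal R).ne_top (top_le_iff.1 (h ▸ hI))
  have := Ideal.iInf_pow_smul_eq_bot_of_isLocalRing (M := M ⧸ D) I hI'
  rw [← Submodule.Quotient.mk_eq_zero, ← Submodule.mem_bot R, ← this, Submodule.mem_iInf]
  intro n
  have h1 : v ∈ D ⊔ I ^ n • (⊤ : Submodule R M) :=
    have hle : D ⊔ I ^ (n + 1) • (⊤ : Submodule R M) ≤ D ⊔ I ^ n • (⊤ : Submodule R M) :=
      sup_le_sup_left (Submodule.smul_mono_left (Ideal.pow_le_pow_right (Nat.le_succ n))) D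
    hle (h n)
  obtain ⟨a, ha, b, hb, rfl⟩ := Submodule.mem_sup.1 h1
  rw [Submodule.Quotient.mk_add, (Submodule.Quotient.mk_eq_zero D).2 ha, zero_add]
  have : D.mkQ b ∈ (I ^ n • (⊤ : Submodule R M)).map D.mkQ := Submodule.mem_map_of_mem hb
  rw [Submodule.map_smul''] at this
  exact Submodule.smul_mono le_rfl le_top this

lemma numaux (a b : ℕ) (f g : ℕ∞) (hf : f ≠ ⊤) (h2 : g ≤ (b : ℕ) * f)
    (h1 : ((a + b : ℕ) : ℕ∞) * f ≤ (a : ℕ) * f + g) :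
    ((a + b : ℕ) : ℕ∞) * f = (a : ℕ) * f + g ∧ ((a + b : ℕ) : ℕ∞) * f ≠ ⊤ ∧
      g = (b : ℕ) * f := by
  lift f to ℕ using hf
  have hg : g ≠ ⊤ := fun hg => by
    rw [hg] at h2
    exact absurd (top_le_iff.1 h2) (by exact_mod_cast ENat.natCast_ne_top _)
  lift g to ℕ using hg
  norm_cast at *
  have : g = b * f := by nlinarith
  refine ⟨?_, ENat.natCast_ne_top _, this⟩
  rw [this]; ring

theorem regOn_of_F (l : List R) (hl : ∀ y ∈ l, y ∈ maximalIdeal R) : ∀ (D : Submodule R M)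
    (_ : F l D 0 ≠ ⊤)
    (_ : ∀ n, F l D n = ((n + l.length).choose l.length : ℕ) * F l D 0), RegOn l D := by
  induction l with
  | nil => intro D _ _; trivial
  | cons y l ih =>
    intro D hfin h
    have hle := F_le l (D ⊔ Ideal.span {y} • ⊤)
    rw [← F_zero] at hle
    have key : ∀ n, F (y :: l) D (n + 1) =
          F (y :: l) D n + F l (D ⊔ Ideal.span {y} • ⊤) (n + 1) ∧ F (y :: l) D (n + 1) ≠ ⊤ ∧
          F l (D ⊔ Ideal.span {y} • ⊤) (n + 1) =
            ((n + 1 + l.length).choose l.length : ℕ) * F (y :: l) D 0 := by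
      intro n
      have h1 := (F_step y l D n).1
      have h2 := hle (n + 1)
      have e1 := h (n + 1)
      have e2 := h n
      rw [List.length_cons] at e1 e2
      rw [choose_step] at e1
      have h1' := h1
      rw [e1, e2] at h1'
      rw [e1, e2]
      exact numaux _ _ _ _ hfin h2 h1'
    refine ⟨?_, ?_⟩
    · intro v hv
      apply krull_inter D (Ideal.ofList (y :: l))
        (Ideal.span_le.2 (fun r hr => hl r hr))
      intro n
      exact (F_step y l D n).2.2 (key n).1 (key n).2.1 v (Submodule.mem_sup_left hv)
    · refine ih (fun z hz => hl z (List.mem_cons_of_mem _ hz)) _ ?_ ?_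
      · rw [← F_zero]; exact hfin
      · intro n
        cases n with
        | zero => simp
        | succ n => rw [← F_zero]; exact (key n).2.2

/-! ### Depth -/

lemma mle : maximalIdeal R ≤ Ideal.jacobson (⊥ : Ideal R) := maximalIdeal_le_jacobson _

/-- Nakayama form: if `K ≤ D + yK` with `y ∈ 𝔪` then `K ≤ D`. -/
lemma nak {D K : Submodule R M} {y : R} (hy : y ∈ maximalIdeal R)
    (h : K ≤ D ⊔ Ideal.span {y} • K) : K ≤ D := by
  refine Submodule.le_of_le_smul_of_le_jacobson_bot (IsNoetherian.noetherian K) ?_ h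
  exact ((Ideal.span_singleton_le_iff_mem _).2 hy).trans mle

/-- Swapping two consecutive elements of a regular sequence. -/
lemma swap {D : Submodule R M} {y z : R} (hym : y ∈ maximalIdeal R)
    (hy : Reg D y) (hz : Reg (D ⊔ Ideal.span {y} • ⊤) z) :
    Reg D z ∧ Reg (D ⊔ Ideal.span {z} • ⊤) y := by
  constructor
  · have : D.comap (LinearMap.lsmul R M z) ≤ D := by
      apply nak hym
      intro u hu
      have hu' : z • u ∈ D := hu
      have := hz u (Submodule.mem_sup_left hu')
      obtain ⟨a, ha, b, hb, rfl⟩ := Submodule.mem_sup.1 this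
      obtain ⟨v, -, rfl⟩ := mem_span_smul.1 hb
      refine Submodule.add_mem _ (Submodule.mem_sup_left ha) (Submodule.mem_sup_right ?_)
      refine mem_span_smul.2 ⟨v, ?_, rfl⟩
      change z • v ∈ D
      apply hy
      rw [smul_add] at hu'
      rw [smul_comm]
      exact (D.add_mem_iff_right (D.smul_mem _ ha)).1 hu'
    exact fun m hm => this hm
  · intro u hu
    obtain ⟨a, ha, b, hb, hab⟩ := Submodule.mem_sup.1 hu
    obtain ⟨v, -, rfl⟩ := mem_span_smul.1 hb
    have hv := hz v (by
      have : z • v = -a + y • u := by rw [← hab]; abel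
      rw [this]
      exact Submodule.add_mem _ (Submodule.mem_sup_left (D.neg_mem ha))
        (Submodule.mem_sup_right (mem_span_smul.2 ⟨_, trivial, rfl⟩)))
    obtain ⟨a', ha', b', hb', rfl⟩ := Submodule.mem_sup.1 hv
    obtain ⟨v', -, rfl⟩ := mem_span_smul.1 hb'
    have : u - z • v' ∈ D := by
      apply hy
      have : y • (u - z • v') = a + z • a' := by
        rw [smul_sub, ← hab, smul_add, smul_comm y z]; abel
      rw [this]
      exact D.add_mem ha (D.smul_mem _ ha')
    have e : u = (u - z • v') + z • v' := by abel
    rw [e]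
    exact Submodule.add_mem _ (Submodule.mem_sup_left this)
        (Submodule.mem_sup_right (mem_span_smul.2 ⟨_, trivial, rfl⟩))

/-- `M/D` has a regular sequence of length `k` in the maximal ideal. -/
def P : ℕ → Submodule R M → Prop
  | 0, D => D ≠ ⊤
  | k + 1, D => ∃ y ∈ maximalIdeal R, Reg D y ∧ P k (D ⊔ Ideal.span {y} • ⊤)

lemma sup_ne_top {D : Submodule R M} {y : R} (hy : y ∈ maximalIdeal R) (h : D ≠ ⊤) :
    D ⊔ Ideal.span {y} • ⊤ ≠ ⊤ := by
  intro h'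
  exact h (top_le_iff.1 (nak hy h'.ge))

lemma P_ne_top {k : ℕ} {D : Submodule R M} (h : P k D) : D ≠ ⊤ := by
  induction k generalizing D with
  | zero => exact h
  | succ k ih =>
    obtain ⟨y, hy, -, h⟩ := h
    intro hD
    apply ih h
    rw [hD, top_sup_eq]

/-- Associated primes over an annihilator. -/
lemma exists_ass (D : Submodule R M) (u : M) (hu : u ∉ D) :
    ∃ (p : Ideal R) (v : M), p.IsPrime ∧ v ∉ D ∧ (∀ r, r ∈ p ↔ r • v ∈ D) ∧
      ∀ r : R, r • u ∈ D → r ∈ p := by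
  have hu' : (Submodule.Quotient.mk u : M ⧸ D) ≠ 0 := by
    rwa [Ne, Submodule.Quotient.mk_eq_zero]
  obtain ⟨p, hp, hle⟩ := exists_le_isAssociatedPrime_of_isNoetherianRing R _ hu'
  rw [isAssociatedPrime_iff] at hp
  obtain ⟨hp, v, hv⟩ := hp
  obtain ⟨v, rfl⟩ := Submodule.Quotient.mk_surjective _ v
  have key : ∀ r, r ∈ p ↔ r • v ∈ D := by
    intro r
    rw [hv, Submodule.mem_colon_singleton, ← Submodule.Quotient.mk_smul, Submodule.mem_bot,
      Submodule.Quotient.mk_eq_zero]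
  refine ⟨p, v, hp, ?_, key, ?_⟩
  · intro hvD
    apply hp.ne_top
    rw [Ideal.eq_top_iff_one, key, one_smul]
    exact hvD
  · intro r hr
    apply hle
    rw [Submodule.mem_colon_singleton, ← Submodule.Quotient.mk_smul, Submodule.mem_bot,
      Submodule.Quotient.mk_eq_zero]
    exact hr

/-- No socle. -/
def NoSoc (D : Submodule R M) : Prop := ∀ u : M, (∀ r ∈ maximalIdeal R, r • u ∈ D) → u ∈ D

lemma exists_reg (D E : Submodule R M) (hD : NoSoc D) (hE : NoSoc E) :
    ∃ w ∈ maximalIdeal R, Reg D w ∧ Reg E w := by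
  by_contra hcon
  push Not at hcon
  have hf : (associatedPrimes R (M ⧸ D) ∪ associatedPrimes R (M ⧸ E)).Finite :=
    (associatedPrimes.finite R _).union (associatedPrimes.finite R _)
  have hsoc : ∀ (D : Submodule R M), NoSoc D →
      ∀ p ∈ associatedPrimes R (M ⧸ D), ¬ maximalIdeal R ≤ p := by
    intro D hD p hp hle
    rw [AssociatedPrimes.mem_iff, isAssociatedPrime_iff] at hp
    obtain ⟨hp, v, hv⟩ := hp
    obtain ⟨v, rfl⟩ := Submodule.Quotient.mk_surjective _ v
    have key : ∀ r, r ∈ p ↔ r • v ∈ D := by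
      intro r
      rw [hv, Submodule.mem_colon_singleton, ← Submodule.Quotient.mk_smul, Submodule.mem_bot,
        Submodule.Quotient.mk_eq_zero]
    apply hp.ne_top
    rw [Ideal.eq_top_iff_one, key, one_smul]
    exact hD v fun r hr => (key r).1 (hle hr)
  have hreg : ∀ (D : Submodule R M) (w : R), ¬ Reg D w →
      ∃ p ∈ associatedPrimes R (M ⧸ D), w ∈ p := by
    intro D w hw
    unfold Reg at hw
    push Not at hw
    obtain ⟨u, h1, h2⟩ := hw
    have hu' : (Submodule.Quotient.mk u : M ⧸ D) ≠ 0 := by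
      rwa [Ne, Submodule.Quotient.mk_eq_zero]
    obtain ⟨p, hp, hle⟩ := exists_le_isAssociatedPrime_of_isNoetherianRing R _ hu'
    refine ⟨p, hp, hle ?_⟩
    rw [Submodule.mem_colon_singleton, ← Submodule.Quotient.mk_smul, Submodule.mem_bot,
      Submodule.Quotient.mk_eq_zero]
    exact h1
  have := (Ideal.subset_union_prime_finite hf (f := id) ⊥ ⊥ (I := maximalIdeal R) (by
    rintro p (hp | hp) - -
    · exact hp.1
    · exact hp.1)).1 (by
    intro w hw
    rw [Set.mem_iUnion₂]
    by_cases h : Reg D w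
    · obtain ⟨p, hp, hwp⟩ := hreg E w (hcon w hw h)
      exact ⟨p, Or.inr hp, hwp⟩
    · obtain ⟨p, hp, hwp⟩ := hreg D w h
      exact ⟨p, Or.inl hp, hwp⟩)
  obtain ⟨p, hp | hp, hle⟩ := this
  · exact hsoc D hD p hp hle
  · exact hsoc E hE p hp hle

lemma noSoc_of_reg {D : Submodule R M} {y : R} (hym : y ∈ maximalIdeal R) (hy : Reg D y) :
    NoSoc D := fun u hu => hy u (hu y hym)

lemma noSoc_transfer {D : Submodule R M} {y z : R}
    (hy : Reg D y) (hz : Reg D z) (hym : y ∈ maximalIdeal R)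
    (h : NoSoc (D ⊔ Ideal.span {y} • ⊤)) : NoSoc (D ⊔ Ideal.span {z} • ⊤) := by
  intro u hu
  obtain ⟨a, ha, b, hb, hab⟩ := Submodule.mem_sup.1 (hu y hym)
  obtain ⟨v, -, rfl⟩ := mem_span_smul.1 hb
  have hv : v ∈ D ⊔ Ideal.span {y} • (⊤ : Submodule R M) := by
    apply h
    intro r hr
    obtain ⟨c, hc, d, hd, hcd⟩ := Submodule.mem_sup.1 (hu r hr)
    obtain ⟨w, -, rfl⟩ := mem_span_smul.1 hd
    have : r • v - y • w ∈ D := by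
      apply hz
      have : z • (r • v - y • w) = y • c - r • a := by
        have e1 : z • v = y • u - a := by rw [← hab]; abel
        have e2 : z • w = r • u - c := by rw [← hcd]; abel
        rw [smul_sub, smul_comm z r, smul_comm z y, e1, e2, smul_sub, smul_sub, smul_comm r y]
        abel
      rw [this]
      exact D.sub_mem (D.smul_mem _ hc) (D.smul_mem _ ha)
    have e : r • v = (r • v - y • w) + y • w := by abel
    rw [e]
    exact Submodule.add_mem _ (Submodule.mem_sup_left this)
        (Submodule.mem_sup_right (mem_span_smul.2 ⟨_, trivial, rfl⟩))
  obtain ⟨c, hc, d, hd, rfl⟩ := Submodule.mem_sup.1 hv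
  obtain ⟨w, -, rfl⟩ := mem_span_smul.1 hd
  have : u - z • w ∈ D := by
    apply hy
    have : y • (u - z • w) = a + z • c := by
      rw [smul_sub, ← hab, smul_add, smul_comm y z]; abel
    rw [this]
    exact D.add_mem ha (D.smul_mem _ hc)
  have e : u = (u - z • w) + z • w := by abel
  rw [e]
  exact Submodule.add_mem _ (Submodule.mem_sup_left this)
      (Submodule.mem_sup_right (mem_span_smul.2 ⟨_, trivial, rfl⟩))

theorem P_quot (k : ℕ) : ∀ (D : Submodule R M) (z : R), z ∈ maximalIdeal R → Reg D z →
    P (k + 1) D → P k (D ⊔ Ideal.span {z} • ⊤) := by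
  induction k with
  | zero => exact fun D z hzm _ h => sup_ne_top hzm (P_ne_top h)
  | succ k ih =>
    intro D z hzm hz ⟨y, hym, hy, hP⟩
    obtain ⟨y2, hy2m, hy2, hP2⟩ := id hP
    have hs : NoSoc (D ⊔ Ideal.span {y} • ⊤) := noSoc_of_reg hy2m hy2
    obtain ⟨w, hwm, hwy, hwz⟩ := exists_reg _ _ hs (noSoc_transfer hy hz hym hs)
    have h1 := ih _ w hwm hwy hP
    obtain ⟨hw, hyw⟩ := swap hym hy hwy
    obtain ⟨-, hzw⟩ := swap hzm hz hwz
    have h2 : P (k + 1) (D ⊔ Ideal.span {w} • ⊤) := ⟨y, hym, hyw, by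
      rwa [sup_right_comm] at h1⟩
    have h3 := ih _ z hzm hzw h2
    exact ⟨w, hwm, hwz, by rwa [sup_right_comm] at h3⟩

/-- Depth bounds the dimension of primes annihilating a nonzero element. -/
theorem P_coheight (k : ℕ) : ∀ (D : Submodule R M), P k D → ∀ (p : PrimeSpectrum R) (u : M),
    u ∉ D → (∀ r ∈ p.asIdeal, r • u ∈ D) → (k : ℕ∞) ≤ Order.coheight p := by
  induction k with
  | zero => intros; simp
  | succ k ih =>
    intro D ⟨y, hym, hy, hP⟩ p u hu hpu
    have hyp : y ∉ p.asIdeal := fun h => hu (hy u (hpu y h))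
    let L : Submodule R M :=
      { carrier := {v | ∀ r ∈ p.asIdeal, r • v ∈ D}
        add_mem' := fun ha hb r hr => by rw [smul_add]; exact D.add_mem (ha r hr) (hb r hr)
        zero_mem' := fun r _ => by rw [smul_zero]; exact D.zero_mem
        smul_mem' := fun c v hv r hr => by rw [smul_comm]; exact D.smul_mem _ (hv r hr) }
    have hL : ¬ L ≤ D ⊔ Ideal.span {y} • ⊤ := by
      intro hle
      have : L ≤ D := by
        apply nak hym
        intro v hv
        obtain ⟨a, ha, b, hb, rfl⟩ := Submodule.mem_sup.1 (hle hv)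
        obtain ⟨w, -, rfl⟩ := mem_span_smul.1 hb
        refine Submodule.add_mem _ (Submodule.mem_sup_left ha) (Submodule.mem_sup_right ?_)
        refine mem_span_smul.2 ⟨w, ?_, rfl⟩
        intro r hr
        apply hy
        have := hv r hr
        rw [smul_add] at this
        rw [smul_comm]
        exact (D.add_mem_iff_right (D.smul_mem _ ha)).1 this
      exact hu (this hpu)
    obtain ⟨v, hvL, hv⟩ := SetLike.not_le_iff_exists.1 hL
    obtain ⟨p', v', hp', hv', hpv', hann⟩ := exists_ass _ v hv
    have := ih _ hP ⟨p', hp'⟩ v' hv' (fun r hr => (hpv' r).1 hr)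
    have hlt : p < ⟨p', hp'⟩ := by
      rw [lt_iff_le_and_ne]
      constructor
      · intro r hr
        exact hann r (Submodule.mem_sup_left (hvL r hr))
      · rintro rfl
        exact hyp (hann y (Submodule.mem_sup_right (mem_span_smul.2 ⟨_, trivial, rfl⟩)))
    calc ((k + 1 : ℕ) : ℕ∞) = k + 1 := by push_cast; rfl
      _ ≤ Order.coheight (⟨p', hp'⟩ : PrimeSpectrum R) + 1 := by gcongr
      _ ≤ _ := Order.coheight_add_one_le hlt

lemma P_of_regOn (l : List R) (hl : ∀ y ∈ l, y ∈ maximalIdeal R) : ∀ D : Submodule R M,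
    D ≠ ⊤ → RegOn l D → P l.length D := by
  induction l with
  | nil => exact fun D h _ => h
  | cons y l ih =>
    intro D hD h
    have hy := hl y List.mem_cons_self
    exact ⟨y, hy, h.1, ih (fun z hz => hl z (List.mem_cons_of_mem _ hz)) _ (sup_ne_top hy hD) h.2⟩

end SCM

set_option linter.unusedSectionVars false

namespace SCM

open IsLocalRing

variable {R : Type*} [CommRing R] [IsLocalRing R] [IsNoetherianRing R]
  {M : Type*} [AddCommGroup M] [Module R M] [Module.Finite R M]

/-- `dim R / I ≤ n`. -/
def DimLE (I : Ideal R) (n : ℕ∞) : Prop :=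
  ∀ p : PrimeSpectrum R, I ≤ p.asIdeal → Order.coheight p ≤ n

lemma dimLE_iff (I : Ideal R) (n : ℕ∞) :
    DimLE I n ↔ ringKrullDim (R ⧸ I) ≤ (n : WithBot ℕ∞) := by
  rw [ringKrullDim_quotient]
  constructor
  · intro h
    rw [Order.krullDim_eq_iSup_coheight]
    refine iSup_le fun a => ?_
    have h1 : Order.coheight a ≤ Order.coheight (a : PrimeSpectrum R) :=
      Order.coheight_le_coheight_apply_of_strictMono
        (fun a : PrimeSpectrum.zeroLocus (R := R) I => (a : PrimeSpectrum R))
        (fun _ _ h => h) a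
    exact_mod_cast h1.trans (h a a.2)
  · intro h p hp
    have h1 := Order.coheight_eq_krullDim_Ici (x := p)
    have h2 : Order.krullDim (Set.Ici p) ≤ Order.krullDim (PrimeSpectrum.zeroLocus (R := R) I) :=
      Order.krullDim_le_of_strictMono
        (fun q => ⟨q.1, hp.trans (show p.asIdeal ≤ q.1.asIdeal from q.2)⟩) (fun _ _ h => h)
    rw [← h1] at h2
    exact_mod_cast h2.trans h

lemma dimLE_mono {I J : Ideal R} (h : I ≤ J) {n : ℕ∞} (hI : DimLE I n) : DimLE J n :=
  fun p hp => hI p (h.trans hp)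

lemma dimLE_step {I : Ideal R} {x : R} {n : ℕ∞} (hx : x ∈ maximalIdeal R)
    (h : DimLE (I ⊔ Ideal.span {x}) n) : DimLE I (n + 1) := by
  rw [dimLE_iff, ← Module.supportDim_quotient_eq_ringKrullDim]
  refine (Module.supportDim_le_supportDim_quotSMulTop_succ (M := R ⧸ I) hx).trans ?_
  have : Module.supportDim R (QuotSMulTop x (R ⧸ I)) ≤ n := by
    rw [dimLE_iff, ringKrullDim_quotient] at h
    rw [Module.supportDim, Module.support_quotSMulTop, Module.support_eq_zeroLocus,
      Ideal.annihilator_quotient, ← PrimeSpectrum.zeroLocus_span {x},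
      ← PrimeSpectrum.zeroLocus_sup]
    exact h
  push_cast
  gcongr

lemma dimLE_list (l : List R) (hl : ∀ y ∈ l, y ∈ maximalIdeal R) : ∀ I : Ideal R,
    DimLE (I ⊔ Ideal.ofList l) 0 → DimLE I l.length := by
  induction l with
  | nil => intro I h; simpa using h
  | cons y l ih =>
    intro I h
    rw [Ideal.ofList_cons, ← sup_assoc] at h
    have := dimLE_step (hl y List.mem_cons_self)
      (ih (fun z hz => hl z (List.mem_cons_of_mem _ hz)) _ h)
    simpa using this

lemma coheight_max (p : PrimeSpectrum R) (h : maximalIdeal R ≤ p.asIdeal) :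
    Order.coheight p = 0 := by
  rw [Order.coheight_eq_zero]
  intro q _
  exact (le_maximalIdeal q.2.ne_top).trans h

lemma dimLE_zero_of_pow {I : Ideal R} {k : ℕ} (h : maximalIdeal R ^ k ≤ I) : DimLE I 0 :=
  fun p hp => (coheight_max p (p.2.le_of_pow_le (h.trans hp))).le

lemma dimLE_quot (D : Submodule R M) (I : Ideal R) {k : ℕ}
    (h : maximalIdeal R ^ k • (⊤ : Submodule R M) ≤ D ⊔ I • ⊤) :
    DimLE (Module.annihilator R (M ⧸ D) ⊔ I) 0 := by
  intro p hp
  have h1 : p ∈ Module.support R ((M ⧸ D) ⧸ I • (⊤ : Submodule R (M ⧸ D))) := by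
    rw [Module.support_quotient, Module.support_eq_zeroLocus]
    exact ⟨le_sup_left.trans hp, le_sup_right.trans hp⟩
  rw [Module.support_eq_zeroLocus] at h1
  refine (coheight_max p (p.2.le_of_pow_le (n := k) (le_trans ?_ h1))).le
  intro r hr
  rw [Module.mem_annihilator]
  intro w
  obtain ⟨w, rfl⟩ := Submodule.Quotient.mk_surjective _ w
  obtain ⟨w, rfl⟩ := Submodule.Quotient.mk_surjective _ w
  rw [← Submodule.Quotient.mk_smul, Submodule.Quotient.mk_eq_zero, ← Submodule.Quotient.mk_smul]
  obtain ⟨a, ha, b, hb, hab⟩ := Submodule.mem_sup.1 (h (Submodule.smul_mem_smul hr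
    (Submodule.mem_top (x := w))))
  rw [← hab, Submodule.Quotient.mk_add, (Submodule.Quotient.mk_eq_zero D).2 ha, zero_add]
  have : D.mkQ b ∈ (I • (⊤ : Submodule R M)).map D.mkQ := Submodule.mem_map_of_mem hb
  rw [Submodule.map_smul''] at this
  exact Submodule.smul_mono le_rfl le_top this

theorem sop_regOn (l : List R) (hl : ∀ y ∈ l, y ∈ maximalIdeal R) : ∀ D : Submodule R M,
    P l.length D → (∃ k : ℕ, maximalIdeal R ^ k • (⊤ : Submodule R M) ≤ D ⊔ Ideal.ofList l • ⊤) →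
    RegOn l D := by
  induction l with
  | nil => exact fun _ _ _ => trivial
  | cons x l ih =>
    intro D hP ⟨k, hk⟩
    have hx := hl x List.mem_cons_self
    have hl' := fun z hz => hl z (List.mem_cons_of_mem _ hz)
    have hreg : Reg D x := by
      intro u hxu
      by_contra hu
      obtain ⟨p, v, hp, hv, hpv, hpu⟩ := exists_ass D u hu
      have h1 := P_coheight _ D hP ⟨p, hp⟩ v hv (fun r hr => (hpv r).1 hr)
      have h2 : DimLE (p ⊔ Ideal.ofList l) 0 := by
        refine dimLE_mono ?_ (dimLE_quot D (Ideal.ofList (x :: l)) hk)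
        refine sup_le (le_trans ?_ le_sup_left) ?_
        · intro r hr
          rw [hpv, ← Submodule.Quotient.mk_eq_zero, Submodule.Quotient.mk_smul]
          exact Module.mem_annihilator.1 hr _
        · rw [Ideal.ofList_cons]
          exact sup_le_sup_right ((Ideal.span_singleton_le_iff_mem _).2 (hpu x hxu)) _
      have h3 := h1.trans (dimLE_list l hl' p h2 ⟨p, hp⟩ le_rfl)
      rw [List.length_cons] at h3
      have h4 : l.length + 1 ≤ l.length := by exact_mod_cast h3
      omega
    refine ⟨hreg, ih hl' _ (P_quot _ D x hx hreg hP) ⟨k, ?_⟩⟩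
    rwa [Ideal.ofList_cons, Submodule.sup_smul, ← sup_assoc] at hk

end SCM

set_option linter.unusedSectionVars false

namespace SCM

open IsLocalRing RingTheory.Sequence

section
variable {R : Type*} [CommRing R] {M : Type*} [AddCommGroup M] [Module R M]

lemma reg_iff (D : Submodule R M) (y : R) : Reg D y ↔ IsSMulRegular (M ⧸ D) y := by
  rw [isSMulRegular_iff_right_eq_zero_of_smul]
  constructor
  · intro h x hx
    obtain ⟨x, rfl⟩ := Submodule.Quotient.mk_surjective _ x
    rw [← Submodule.Quotient.mk_smul, Submodule.Quotient.mk_eq_zero] at hx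
    exact (Submodule.Quotient.mk_eq_zero _).2 (h x hx)
  · intro h m hm
    rw [← Submodule.Quotient.mk_eq_zero] at hm ⊢
    exact h _ hm

/-- `(M / D) / y (M / D) ≃ M / (D + yM)`. -/
noncomputable def quotE (D : Submodule R M) (y : R) :
    QuotSMulTop y (M ⧸ D) ≃ₗ[R] M ⧸ (D ⊔ Ideal.span {y} • (⊤ : Submodule R M)) :=
  (Submodule.quotEquivOfEq _ _ (by
    rw [Submodule.map_smul'', Submodule.map_top, Submodule.range_mkQ,
      Submodule.ideal_span_singleton_smul])).trans
    (Submodule.quotientQuotientEquivQuotientSup D (Ideal.span {y} • (⊤ : Submodule R M)))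

lemma regOn_iff (l : List R) : ∀ D : Submodule R M, RegOn l D ↔ IsWeaklyRegular (M ⧸ D) l := by
  induction l with
  | nil => intro D; simp [RegOn]
  | cons y l ih =>
    intro D
    rw [isWeaklyRegular_cons_iff, ← reg_iff, (quotE D y).isWeaklyRegular_congr, ← ih]
    rfl

lemma regOn_bot_iff (l : List R) : RegOn l (⊥ : Submodule R M) ↔ IsWeaklyRegular M l := by
  rw [regOn_iff]
  exact (Submodule.quotEquivOfEqBot _ rfl).isWeaklyRegular_congr l

end

variable {R : Type*} [CommRing R] [IsLocalRing R] [IsNoetherianRing R]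
  {M : Type*} [AddCommGroup M] [Module R M] [Module.Finite R M]

lemma moduleDim_eq : moduleDim R M = Module.supportDim R M :=
  (Module.supportDim_eq_ringKrullDim_quotient_annihilator R M).symm

lemma moduleDim_congr {N : Type*} [AddCommGroup N] [Module R N] [Module.Finite R N]
    (e : M ≃ₗ[R] N) : moduleDim R M = moduleDim R N := by
  rw [moduleDim_eq, moduleDim_eq, Module.supportDim_eq_of_equiv e]

lemma coheight_le_dim {p : PrimeSpectrum R} (hp : p ∈ Module.support R M) :
    (Order.coheight p : WithBot ℕ∞) ≤ moduleDim R M := by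
  rw [Module.support_eq_zeroLocus] at hp
  unfold moduleDim
  generalize hx : ringKrullDim (R ⧸ Module.annihilator R M) = x
  cases x with
  | bot =>
    have h0 := (dimLE_iff (Module.annihilator R M) 0).2 (by rw [hx]; exact bot_le)
    exfalso
    have : Nontrivial (R ⧸ Module.annihilator R M) :=
      Ideal.Quotient.nontrivial_iff.2 (fun h => p.2.ne_top (top_le_iff.1 (h ▸ hp)))
    have := ringKrullDim_nonneg_of_nontrivial (R := R ⧸ Module.annihilator R M)
    rw [hx] at this
    simp at this
  | coe n =>
    have h0 := (dimLE_iff (Module.annihilator R M) n).2 hx.le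
    exact_mod_cast h0 p hp

lemma exists_coheight {e : ℕ} (h : moduleDim R M = (e : WithBot ℕ∞)) :
    ∃ p ∈ Module.support R M, (e : ℕ∞) ≤ Order.coheight p := by
  by_contra! hcon
  cases e with
  | zero =>
    have : Module.support R M = ∅ := by
      ext p; simp only [Set.mem_empty_iff_false, iff_false]
      intro hp; simpa using hcon p hp
    rw [Module.support_eq_empty_iff] at this
    rw [moduleDim_eq, Module.supportDim_eq_bot_of_subsingleton] at h
    exact absurd h (by simp)
  | succ e =>
    have : DimLE (Module.annihilator R M) e := by
      intro p hp
      have := hcon p (by rw [Module.support_eq_zeroLocus]; exact hp)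
      push_cast at this
      exact Order.le_of_lt_add_one this
    rw [dimLE_iff] at this
    have h2 : ((e + 1 : ℕ) : WithBot ℕ∞) ≤ (e : ℕ∞) := h ▸ this
    have : e + 1 ≤ e := by exact_mod_cast h2
    omega

lemma dim_quot (E : Submodule R M) {e : ℕ} (h : moduleDim R M = (e : WithBot ℕ∞))
    (hE : moduleDim R E < moduleDim R M) : moduleDim R (M ⧸ E) = (e : WithBot ℕ∞) := by
  apply le_antisymm
  · rw [← h, moduleDim_eq, moduleDim_eq]
    exact Module.supportDim_le_of_surjective E.mkQ E.mkQ_surjective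
  · obtain ⟨p, hp, hpe⟩ := exists_coheight h
    rw [Module.support_of_exact (f := E.subtype) (g := E.mkQ)
      (LinearMap.exact_subtype_mkQ E) E.subtype_injective E.mkQ_surjective] at hp
    have hpe' : (e : WithBot ℕ∞) ≤ Order.coheight p := by exact_mod_cast hpe
    rcases hp with hp | hp
    · exact absurd (hpe'.trans (coheight_le_dim hp)) (by rw [← h]; exact not_le.2 hE)
    · exact hpe'.trans (coheight_le_dim hp)

lemma nontrivial_of_dim {e : ℕ} (h : moduleDim R M = (e : WithBot ℕ∞)) : Nontrivial M := by
  by_contra hcon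
  rw [not_nontrivial_iff_subsingleton] at hcon
  rw [moduleDim_eq, Module.supportDim_eq_bot_of_subsingleton] at h
  exact absurd h (by simp)

lemma isCM_P {e : ℕ} (h : moduleDim R M = (e : WithBot ℕ∞)) (hM : IsCM R M) :
    P e (⊥ : Submodule R M) := by
  have := nontrivial_of_dim h
  have hdep : moduleDepth R M = (e : ℕ∞) := by
    unfold IsCM at hM
    rw [h] at hM
    exact_mod_cast hM
  have : ∃ rs : List R, rs.length = e ∧ (∀ r ∈ rs, r ∈ maximalIdeal R) ∧ IsRegular M rs := by
    cases e with
    | zero => exact ⟨[], rfl, by simp, (IsRegular.nil R M)⟩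
    | succ e =>
      by_contra! hcon
      have : moduleDepth R M ≤ e := by
        refine sSup_le ?_
        rintro n ⟨rs, rfl, hm, hr⟩
        have h1 : (rs.length : ℕ∞) ≤ (e + 1 : ℕ) := by
          rw [← hdep]; exact le_sSup ⟨rs, rfl, hm, hr⟩
        have h2 : rs.length ≤ e + 1 := by exact_mod_cast h1
        have h3 : rs.length ≠ e + 1 := fun h => hcon rs h hm hr
        exact_mod_cast (by omega : rs.length ≤ e)
      rw [hdep] at this
      have : e + 1 ≤ e := by exact_mod_cast this
      omega
  obtain ⟨rs, rfl, hm, hr⟩ := this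
  exact P_of_regOn rs hm ⊥ bot_ne_top ((regOn_bot_iff rs).2 hr.toIsWeaklyRegular)

lemma isCM_of_regOn [Nontrivial M] (l : List R) (hl : ∀ r ∈ l, r ∈ maximalIdeal R)
    (h : moduleDim R M ≤ (l.length : WithBot ℕ∞)) (hr : RegOn l (⊥ : Submodule R M)) :
    IsCM R M := by
  have hreg : IsRegular M l :=
    (IsLocalRing.isRegular_iff_isWeaklyRegular_of_subset_maximalIdeal hl).2
      ((regOn_bot_iff l).1 hr)
  have h1 : (l.length : ℕ∞) ≤ moduleDepth R M := le_sSup ⟨l, rfl, hl, hreg⟩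
  have h3 : moduleDim R M = (l.length : WithBot ℕ∞) := by
    refine le_antisymm h ?_
    rw [moduleDim_eq, ← Module.supportDim_add_length_eq_supportDim_of_isRegular l hreg]
    have : Nontrivial (M ⧸ Ideal.ofList l • (⊤ : Submodule R M)) :=
      Submodule.Quotient.nontrivial_iff.2 hreg.top_ne_smul.symm
    have h0 : (0 : WithBot ℕ∞) ≤
        Module.supportDim R (M ⧸ Ideal.ofList l • (⊤ : Submodule R M)) := by
      have := Module.supportDim_ne_bot_of_nontrivial R (M ⧸ Ideal.ofList l • (⊤ : Submodule R M))
      revert this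
      generalize Module.supportDim R (M ⧸ Ideal.ofList l • (⊤ : Submodule R M)) = x
      cases x with
      | bot => simp
      | coe n => intro _; exact_mod_cast zero_le
    exact le_add_of_nonneg_left h0
  have h2 : moduleDepth R M ≤ l.length := by
    refine sSup_le ?_
    rintro n ⟨rs, rfl, hm, hrs⟩
    have := P_of_regOn rs hm (⊥ : Submodule R M) bot_ne_top ((regOn_bot_iff rs).2 hrs.toIsWeaklyRegular)
    obtain ⟨u, hu⟩ := exists_ne (0 : M)
    obtain ⟨p, v, hp, hv, hpv, -⟩ := exists_ass (⊥ : Submodule R M) u (by simpa using hu)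
    have h4 := P_coheight _ ⊥ this ⟨p, hp⟩ v hv (fun r hr => (hpv r).1 hr)
    have h5 : (⟨p, hp⟩ : PrimeSpectrum R) ∈ Module.support R M := by
      rw [Module.support_eq_zeroLocus]
      intro r hr
      exact (hpv r).2 (by rw [Module.mem_annihilator.1 hr]; exact zero_mem _)
    have h6 := (coheight_le_dim h5).trans h
    exact h4.trans (by exact_mod_cast h6)
  unfold IsCM
  rw [le_antisymm h2 h1, h3]
  rfl

end SCM

set_option linter.unusedSectionVars false

namespace SCM

open IsLocalRing

variable {R : Type*} [CommRing R] [IsLocalRing R] [IsNoetherianRing R]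
  {M : Type*} [AddCommGroup M] [Module R M] [Module.Finite R M]

lemma fl_of_dimLE (h : DimLE (Module.annihilator R M) 0) : IsFiniteLength R M := by
  rw [isFiniteLength_iff_isNoetherian_isArtinian]
  refine ⟨inferInstance, ?_⟩
  rw [dimLE_iff] at h
  have h1 : Ring.KrullDimLE 0 (R ⧸ Module.annihilator R M) :=
    Order.krullDimLE_iff 0 _ |>.2 (by exact_mod_cast h)
  have h2 : IsArtinianRing (R ⧸ Module.annihilator R M) :=
    isArtinianRing_iff_krullDimLE_zero.2 h1
  let _ : Module (R ⧸ Module.annihilator R M) M := Module.quotientAnnihilator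
  have : IsScalarTower R (R ⧸ Module.annihilator R M) M :=
    Module.IsTorsionBySet.isScalarTower _
  have : Module.Finite (R ⧸ Module.annihilator R M) M :=
    Module.Finite.of_restrictScalars_finite R _ _
  have : IsArtinian (R ⧸ Module.annihilator R M) M := inferInstance
  exact isArtinian_of_surjective_algebraMap (S := R) (R := R ⧸ Module.annihilator R M)
    Ideal.Quotient.mk_surjective

lemma exists_pow_of_fl (h : IsFiniteLength R M) :
    ∃ k : ℕ, maximalIdeal R ^ k • (⊤ : Submodule R M) = ⊥ := by
  have := (isFiniteLength_iff_isNoetherian_isArtinian.1 h).2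
  obtain ⟨k, hk⟩ := IsArtinian.monotone_stabilizes (R := R) (M := M)
    ⟨fun n => OrderDual.toDual (maximalIdeal R ^ n • (⊤ : Submodule R M)), fun a b hab =>
      Submodule.smul_mono_left (Ideal.pow_le_pow_right hab)⟩
  have h1 : maximalIdeal R ^ k • (⊤ : Submodule R M) = maximalIdeal R ^ (k + 1) • ⊤ :=
    hk (k + 1) (Nat.le_succ k)
  refine ⟨k, ?_⟩
  refine Submodule.eq_bot_of_le_smul_of_le_jacobson_bot (maximalIdeal R) _
    (IsNoetherian.noetherian _) ?_ mle
  rw [← Submodule.mul_smul, ← pow_succ']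
  exact h1.le

lemma exists_pow_of_fl_quot {K : Submodule R M} (h : IsFiniteLength R (M ⧸ K)) :
    ∃ k : ℕ, maximalIdeal R ^ k • (⊤ : Submodule R M) ≤ K := by
  obtain ⟨k, hk⟩ := exists_pow_of_fl h
  refine ⟨k, ?_⟩
  have h1 : (maximalIdeal R ^ k • (⊤ : Submodule R M)).map K.mkQ = ⊥ := by
    rw [Submodule.map_smul'', Submodule.map_top, Submodule.range_mkQ, hk]
  rw [← LinearMap.le_ker_iff_map] at h1
  simpa using h1

/-- The system of parameters condition in terms of primes. -/
lemma sop_dimLE {q : Ideal R} (h : IsFiniteLength R (M ⧸ q • (⊤ : Submodule R M))) :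
    DimLE (Module.annihilator R M ⊔ q) 0 := by
  obtain ⟨k, hk⟩ := exists_pow_of_fl_quot h
  have := dimLE_quot (⊥ : Submodule R M) q (k := k) (by simpa using hk)
  rwa [(Submodule.quotEquivOfEqBot (⊥ : Submodule R M) rfl).annihilator_eq] at this

lemma fl_of_sop {N : Type*} [AddCommGroup N] [Module R N] [Module.Finite R N] {I q : Ideal R}
    (h : DimLE (I ⊔ q) 0) (hI : I ≤ Module.annihilator R N) (n : ℕ) :
    IsFiniteLength R (N ⧸ q ^ (n + 1) • (⊤ : Submodule R N)) := by
  apply fl_of_dimLE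
  intro p hp
  have h1 : p ∈ Module.support R (N ⧸ q ^ (n + 1) • (⊤ : Submodule R N)) := by
    rw [Module.support_eq_zeroLocus]; exact hp
  rw [Module.support_quotient, Module.support_eq_zeroLocus] at h1
  exact h p (sup_le (hI.trans h1.1) (p.2.le_of_pow_le h1.2))

end SCM

set_option linter.unusedSectionVars false

namespace SCM

open IsLocalRing

section
variable {R : Type*} [CommRing R] {M : Type*} [AddCommGroup M] [Module R M]

lemma moduleLength_eq : moduleLength R M = (Module.length R M : WithBot ℕ∞) :=
  (Module.coe_length R M).symm

lemma length_add (E : Submodule R M) (I : Ideal R) :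
    Module.length R (M ⧸ I • (⊤ : Submodule R M)) =
      Module.length R (E ⧸ (I • (⊤ : Submodule R M)).comap E.subtype) +
      Module.length R ((M ⧸ E) ⧸ I • (⊤ : Submodule R (M ⧸ E))) := by
  have e : ((M ⧸ E) ⧸ I • (⊤ : Submodule R (M ⧸ E))) ≃ₗ[R] M ⧸ (E ⊔ I • (⊤ : Submodule R M)) :=
    (Submodule.quotEquivOfEq _ _ (by
      rw [Submodule.map_smul'', Submodule.map_top, Submodule.range_mkQ])).trans
      (Submodule.quotientQuotientEquivQuotientSup E (I • (⊤ : Submodule R M)))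
  rw [e.length_eq]
  refine Module.length_eq_add_of_exact
    (Submodule.mapQ _ _ E.subtype le_rfl)
    (Submodule.factor (le_sup_right : I • (⊤ : Submodule R M) ≤ E ⊔ I • ⊤)) ?_ ?_ ?_
  · rw [← LinearMap.ker_eq_bot, Submodule.ker_mapQ, Submodule.mkQ_map_self]
  · exact Submodule.factor_surjective _
  · intro y
    obtain ⟨y, rfl⟩ := Submodule.Quotient.mk_surjective _ y
    constructor
    · intro h
      have h' : (Submodule.Quotient.mk y : M ⧸ (E ⊔ I • (⊤ : Submodule R M))) = 0 := h
      rw [Submodule.Quotient.mk_eq_zero] at h'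
      obtain ⟨a, ha, b, hb, rfl⟩ := Submodule.mem_sup.1 h'
      refine ⟨Submodule.Quotient.mk ⟨a, ha⟩, ?_⟩
      rw [Submodule.Quotient.mk_add, (Submodule.Quotient.mk_eq_zero _).2 hb, add_zero]
      rfl
    · rintro ⟨w, hw⟩
      obtain ⟨w, rfl⟩ := Submodule.Quotient.mk_surjective _ w
      rw [← hw]
      change (Submodule.Quotient.mk (w : M) : M ⧸ (E ⊔ I • (⊤ : Submodule R M))) = 0
      rw [Submodule.Quotient.mk_eq_zero]
      exact Submodule.mem_sup_left w.2

lemma smul_le_comap (E : Submodule R M) (I : Ideal R) :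
    I • (⊤ : Submodule R E) ≤ (I • (⊤ : Submodule R M)).comap E.subtype := by
  rw [← Submodule.map_le_iff_le_comap, Submodule.map_smul'']
  exact Submodule.smul_mono le_rfl le_top

lemma length_sub_le (E : Submodule R M) (I : Ideal R) :
    Module.length R (M ⧸ I • (⊤ : Submodule R M)) ≤
      Module.length R (E ⧸ I • (⊤ : Submodule R E)) +
      Module.length R ((M ⧸ E) ⧸ I • (⊤ : Submodule R (M ⧸ E))) := by
  rw [length_add E I]
  gcongr
  exact Module.length_le_of_surjective (Submodule.factor (smul_le_comap E I))
    (Submodule.factor_surjective _)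

lemma length_sub_eq (E : Submodule R M) (I : Ideal R)
    (h : E ⊓ I • (⊤ : Submodule R M) ≤ I • E) :
    Module.length R (M ⧸ I • (⊤ : Submodule R M)) =
      Module.length R (E ⧸ I • (⊤ : Submodule R E)) +
      Module.length R ((M ⧸ E) ⧸ I • (⊤ : Submodule R (M ⧸ E))) := by
  rw [length_add E I]
  congr 1
  refine (Submodule.quotEquivOfEq _ _ (le_antisymm ?_ (smul_le_comap E I))).length_eq
  intro w hw
  have h1 := h ⟨w.2, hw⟩
  have h2 : (I • (⊤ : Submodule R E)).map E.subtype = I • E := by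
    rw [Submodule.map_smul'', Submodule.map_top, Submodule.range_subtype]
  rw [← h2] at h1
  obtain ⟨z, hz, hzw⟩ := h1
  rwa [← Subtype.ext hzw]

lemma smul_sup_ann {A B : Ideal R} (hB : B ≤ Module.annihilator R M) (n : ℕ) :
    (A ⊔ B) ^ n • (⊤ : Submodule R M) = A ^ n • (⊤ : Submodule R M) := by
  induction n with
  | zero => simp
  | succ n ih =>
    rw [pow_succ', Submodule.mul_smul, ih, Submodule.sup_smul, pow_succ', Submodule.mul_smul]
    have : B • (A ^ n • (⊤ : Submodule R M)) = ⊥ := by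
      rw [eq_bot_iff, Submodule.smul_le]
      intro r hr m _
      rw [Module.mem_annihilator.1 (hB hr) m]
      exact zero_mem _
    rw [this, sup_bot_eq]

lemma length_congr {N : Type*} [AddCommGroup N] [Module R N] (e : M ≃ₗ[R] N) (I : Ideal R) :
    Module.length R (M ⧸ I • (⊤ : Submodule R M)) =
      Module.length R (N ⧸ I • (⊤ : Submodule R N)) := by
  refine (Submodule.Quotient.equiv _ _ e ?_).length_eq
  erw [Submodule.map_smul'', Submodule.map_top, LinearEquiv.range]

/-- One step of the filtration. -/
lemma filt_le {U V : Submodule R M} (h : U ≤ V) (I : Ideal R) :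
    Module.length R (V ⧸ I • (⊤ : Submodule R V)) ≤
      Module.length R (U ⧸ I • (⊤ : Submodule R U)) +
      Module.length R ((V ⧸ U.comap V.subtype) ⧸
        I • (⊤ : Submodule R (V ⧸ U.comap V.subtype))) := by
  rw [← length_congr (Submodule.comapSubtypeEquivOfLe h) I]
  exact length_sub_le _ _

lemma filt_eq {U V : Submodule R M} (h : U ≤ V) {A B : Ideal R}
    (hB : B ≤ Module.annihilator R V) (n : ℕ)
    (hA : U.comap V.subtype ⊓ A ^ n • (⊤ : Submodule R V) ≤ A ^ n • U.comap V.subtype) :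
    Module.length R (V ⧸ (A ⊔ B) ^ n • (⊤ : Submodule R V)) =
      Module.length R (U ⧸ (A ⊔ B) ^ n • (⊤ : Submodule R U)) +
      Module.length R ((V ⧸ U.comap V.subtype) ⧸
        (A ⊔ B) ^ n • (⊤ : Submodule R (V ⧸ U.comap V.subtype))) := by
  rw [← length_congr (Submodule.comapSubtypeEquivOfLe h)]
  apply length_sub_eq
  rw [smul_sup_ann hB]
  exact hA.trans (Submodule.smul_mono_left (Ideal.pow_right_mono le_sup_left n))

lemma F_bot (l : List R) (n : ℕ) : F l (⊥ : Submodule R M) n =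
    Module.length R (M ⧸ (Ideal.ofList l) ^ (n + 1) • (⊤ : Submodule R M)) := by
  unfold F
  rw [bot_sup_eq]

end

lemma sum_eq {t : ℕ} : ∀ (g a : Fin (t + 1) → ℕ∞), g 0 = a 0 →
    (∀ i : Fin t, g i.succ = g i.castSucc + a i.succ) → g (Fin.last t) = ∑ i, a i := by
  induction t with
  | zero => intro g a h _; simpa using h
  | succ t ih =>
    intro g a h0 h
    rw [Fin.sum_univ_castSucc, ← ih (fun i => g i.castSucc) (fun i => a i.castSucc) h0
      (fun i => h i.castSucc)]
    exact h (Fin.last t)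

lemma sum_le {t : ℕ} : ∀ (g a : Fin (t + 1) → ℕ∞), g 0 ≤ a 0 →
    (∀ i : Fin t, g i.succ ≤ g i.castSucc + a i.succ) → g (Fin.last t) ≤ ∑ i, a i := by
  induction t with
  | zero => intro g a h _; simpa using h
  | succ t ih =>
    intro g a h0 h
    rw [Fin.sum_univ_castSucc]
    refine (h (Fin.last t)).trans (add_le_add_left ?_ _)
    exact ih (fun i => g i.castSucc) (fun i => a i.castSucc) h0 (fun i => h i.castSucc)

lemma termwise {ι : Type*} [Fintype ι] (a c : ι → ℕ∞) (hc : ∀ i, c i ≠ ⊤) (h : ∀ i, a i ≤ c i)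
    (hs : ∑ i, c i ≤ ∑ i, a i) : ∀ i, a i = c i := by
  have ha : ∀ i, a i ≠ ⊤ := fun i => ne_top_of_le_ne_top (hc i) (h i)
  lift a to ι → ℕ using ha
  lift c to ι → ℕ using hc
  beta_reduce at hs h
  norm_cast at hs
  have h' : ∀ i, a i ≤ c i := fun i => by exact_mod_cast h i
  have := (Finset.sum_eq_sum_iff_of_le (fun i _ => h' i)).1
    (le_antisymm (Finset.sum_le_sum (fun i _ => h' i)) hs)
  intro i
  show ((a i : ℕ) : ℕ∞) = (c i : ℕ)
  exact_mod_cast this i (Finset.mem_univ i)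

end SCM

set_option linter.unusedSectionVars false

namespace SCM

open IsLocalRing

section
variable {R : Type*} [CommRing R] {N : Type*} [AddCommGroup N] [Module R N]

lemma len_F (l : List R) {q B : Ideal R} (hq : q = Ideal.ofList l ⊔ B)
    (hB : B ≤ Module.annihilator R N) (n : ℕ) :
    Module.length R (N ⧸ q ^ (n + 1) • (⊤ : Submodule R N)) = F l (⊥ : Submodule R N) n := by
  rw [F_bot, hq]
  exact (Submodule.quotEquivOfEq _ _ (smul_sup_ann hB (n + 1))).length_eq

lemma ann_quot (E : Submodule R N) : Module.annihilator R N ≤ Module.annihilator R (N ⧸ E) :=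
  E.mkQ.annihilator_le_of_surjective E.mkQ_surjective

lemma ann_sub (E : Submodule R N) : Module.annihilator R N ≤ Module.annihilator R E :=
  E.subtype.annihilator_le_of_injective E.subtype_injective

lemma span_split {d : ℕ} (x : Fin d → R) (k : ℕ) : Ideal.span (Set.range x) =
    Ideal.ofList ((List.ofFn x).take k) ⊔
      Ideal.span {r : R | ∃ j : Fin d, k ≤ (j : ℕ) ∧ r = x j} := by
  apply le_antisymm
  · rw [Ideal.span_le]
    rintro _ ⟨j, rfl⟩
    by_cases h : k ≤ (j : ℕ)
    · exact Ideal.mem_sup_right (Ideal.subset_span ⟨j, h, rfl⟩)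
    · refine Ideal.mem_sup_left (Ideal.subset_span ?_)
      show x j ∈ (List.ofFn x).take k
      rw [List.mem_take_iff_getElem]
      exact ⟨j, by simp; omega, by simp⟩
  · refine sup_le (Ideal.span_le.2 ?_) (Ideal.span_le.2 ?_)
    · intro r hr
      have := List.mem_of_mem_take (show r ∈ (List.ofFn x).take k from hr)
      exact Ideal.subset_span ((List.mem_ofFn' x r).1 this)
    · rintro r ⟨j, -, rfl⟩
      exact Ideal.subset_span ⟨j, rfl⟩

lemma predD_zero {t : ℕ} (D : Fin (t + 1) → Submodule R N) : predD D 0 = ⊥ := by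
  simp [predD]

lemma predD_succ {t : ℕ} (D : Fin (t + 1) → Submodule R N) (i : Fin t) :
    predD D i.succ = D i.castSucc := by
  simp only [predD, Fin.val_succ, Nat.add_one_ne_zero, dite_false, Nat.add_sub_cancel]
  rfl
end

variable {R : Type*} [CommRing R] [IsLocalRing R] [IsNoetherianRing R]
  {M : Type*} [AddCommGroup M] [Module R M] [Module.Finite R M]
  {d t : ℕ} (hd : moduleDim R M = (d : WithBot ℕ∞))
  (D : Fin (t + 1) → Submodule R M) (hD : IsDimFiltration R M D)
  (ds : Fin (t + 1) → ℕ)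
  (hds : ∀ i, (D i = ⊥ ∧ ds i = 0) ∨ moduleDim R ↥(D i) = (ds i : WithBot ℕ∞))

lemma dim_sub_le (E : Submodule R M) : moduleDim R E ≤ moduleDim R M := by
  rw [moduleDim_eq, moduleDim_eq]
  exact Module.supportDim_le_of_injective E.subtype E.subtype_injective

lemma dim_bot : moduleDim R (⊥ : Submodule R M) = ⊥ := by
  rw [moduleDim_eq, Module.supportDim_eq_bot_of_subsingleton]

lemma ds_succ {D : Fin (t + 1) → Submodule R M} (hD : IsDimFiltration R M D)
    {ds : Fin (t + 1) → ℕ}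
    (hds : ∀ i, (D i = ⊥ ∧ ds i = 0) ∨ moduleDim R ↥(D i) = (ds i : WithBot ℕ∞)) (i : Fin t) :
    moduleDim R ↥(D i.succ) = (ds i.succ : WithBot ℕ∞) := by
  rcases hds i.succ with ⟨h, -⟩ | h
  · have := (hD.2.2 i).2.1
    rw [h, dim_bot] at this
    exact absurd this not_lt_bot
  · exact h

lemma H0m_pow : ∃ k : ℕ, maximalIdeal R ^ k • H0m R M = ⊥ := by
  have hmono : Monotone (fun n : ℕ =>
      Submodule.torsionBySet R M ((maximalIdeal R ^ n : Ideal R) : Set R)) := by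
    intro a b hab m hm
    rw [Submodule.mem_torsionBySet_iff] at hm ⊢
    exact fun r => hm ⟨r.1, Ideal.pow_le_pow_right hab r.2⟩
  obtain ⟨k, hk⟩ := monotone_stabilizes_iff_noetherian.2
    (inferInstance : IsNoetherian R M) ⟨_, hmono⟩
  refine ⟨k, ?_⟩
  have : H0m R M ≤ Submodule.torsionBySet R M ((maximalIdeal R ^ k : Ideal R) : Set R) := by
    refine iSup_le fun n => ?_
    have h1 := hk (max k n) (le_max_left _ _)
    exact (hmono (le_max_right k n)).trans h1.ge
  rw [eq_bot_iff, Submodule.smul_le]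
  intro r hr m hm
  have := (Submodule.mem_torsionBySet_iff _ _).1 (this hm) ⟨r, hr⟩
  rw [Submodule.mem_bot]
  exact this

lemma ds_zero {D : Fin (t + 1) → Submodule R M} (hD : IsDimFiltration R M D)
    {ds : Fin (t + 1) → ℕ}
    (hds : ∀ i, (D i = ⊥ ∧ ds i = 0) ∨ moduleDim R ↥(D i) = (ds i : WithBot ℕ∞)) :
    ds 0 = 0 := by
  rcases hds 0 with ⟨-, h⟩ | h
  · exact h
  · obtain ⟨k, hk⟩ := H0m_pow (R := R) (M := M)
    rw [← hD.1] at hk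
    have : DimLE (Module.annihilator R (D 0)) 0 := by
      refine dimLE_zero_of_pow (k := k) ?_
      intro r hr
      rw [Module.mem_annihilator]
      intro m
      have := Submodule.smul_mem_smul hr m.2
      rw [hk, Submodule.mem_bot] at this
      exact Subtype.ext this
    rw [dimLE_iff] at this
    have h1 : ((ds 0 : ℕ) : WithBot ℕ∞) ≤ ((0 : ℕ∞) : WithBot ℕ∞) := h ▸ this
    have : ds 0 ≤ 0 := by exact_mod_cast h1
    omega

lemma ds_last {d : ℕ} (hd : moduleDim R M = (d : WithBot ℕ∞))
    {D : Fin (t + 1) → Submodule R M} (hD : IsDimFiltration R M D)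
    {ds : Fin (t + 1) → ℕ}
    (hds : ∀ i, (D i = ⊥ ∧ ds i = 0) ∨ moduleDim R ↥(D i) = (ds i : WithBot ℕ∞)) :
    ds (Fin.last t) = d := by
  have hnt := nontrivial_of_dim hd
  rcases hds (Fin.last t) with ⟨h, -⟩ | h
  · rw [hD.2.1] at h
    exact absurd h top_ne_bot
  · rw [hD.2.1, moduleDim_congr (Submodule.topEquiv), hd] at h
    exact_mod_cast h.symm

lemma ds_le {d : ℕ} (hd : moduleDim R M = (d : WithBot ℕ∞))
    {D : Fin (t + 1) → Submodule R M}
    {ds : Fin (t + 1) → ℕ}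
    (hds : ∀ i, (D i = ⊥ ∧ ds i = 0) ∨ moduleDim R ↥(D i) = (ds i : WithBot ℕ∞))
    (i : Fin (t + 1)) : ds i ≤ d := by
  rcases hds i with ⟨-, h⟩ | h
  · omega
  · have := dim_sub_le (D i)
    rw [h, hd] at this
    exact_mod_cast this

/-- For a good system of parameters the elements `x_j`, `j > d_i`, annihilate `D_i`. -/
lemma good_ann {d : ℕ} (hd : moduleDim R M = (d : WithBot ℕ∞))
    {D : Fin (t + 1) → Submodule R M} (hD : IsDimFiltration R M D)
    {ds : Fin (t + 1) → ℕ}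
    (hds : ∀ i, (D i = ⊥ ∧ ds i = 0) ∨ moduleDim R ↥(D i) = (ds i : WithBot ℕ∞))
    {x : Fin d → R} (hx : IsGoodSOP R M D ds x) (i : Fin (t + 1)) :
    Ideal.span {r : R | ∃ j : Fin d, ds i ≤ (j : ℕ) ∧ r = x j} ≤ Module.annihilator R (D i) := by
  by_cases hi : (i : ℕ) < t
  · intro r hr
    rw [Module.mem_annihilator]
    intro m
    have h1 : r • (m : M) ∈ D i ⊓
        (Ideal.span {r : R | ∃ j : Fin d, ds i ≤ (j : ℕ) ∧ r = x j}) • (⊤ : Submodule R M) :=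
      ⟨(D i).smul_mem r m.2, Submodule.smul_mem_smul hr Submodule.mem_top⟩
    rw [hx.2 i hi, Submodule.mem_bot] at h1
    exact Subtype.ext h1
  · have : i = Fin.last t := by ext; simp; omega
    rw [Ideal.span_le]
    rintro r ⟨j, hj, -⟩
    rw [this, ds_last hd hD hds] at hj
    omega

section main
variable {d : ℕ} (hd : moduleDim R M = (d : WithBot ℕ∞))
    {D : Fin (t + 1) → Submodule R M} (hD : IsDimFiltration R M D)
    {ds : Fin (t + 1) → ℕ}
    (hds : ∀ i, (D i = ⊥ ∧ ds i = 0) ∨ moduleDim R ↥(D i) = (ds i : WithBot ℕ∞))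
    {x : Fin d → R} (hx : IsGoodSOP R M D ds x)

/-- `𝒟_i`. -/
abbrev Gr (D : Fin (t + 1) → Submodule R M) (i : Fin (t + 1)) : Type _ :=
  ↥(D i) ⧸ (predD D i).comap (D i).subtype

/-- The initial segment of the system of parameters acting on `D_i`. -/
def seg (ds : Fin (t + 1) → ℕ) (x : Fin d → R) (i : Fin (t + 1)) : List R :=
  (List.ofFn x).take (ds i)

lemma seg_length (hle : ds i ≤ d) : (seg ds x i).length = ds i := by
  simp [seg, hle]

lemma seg_mem (hx : ∀ i, x i ∈ maximalIdeal R) (i : Fin (t + 1)) :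
    ∀ y ∈ seg ds x i, y ∈ maximalIdeal R := by
  intro y hy
  obtain ⟨j, rfl⟩ := (List.mem_ofFn' x y).1 (List.mem_of_mem_take hy)
  exact hx j

lemma gr_F (hd : moduleDim R M = (d : WithBot ℕ∞)) (hD : IsDimFiltration R M D)
    (hds : ∀ i, (D i = ⊥ ∧ ds i = 0) ∨ moduleDim R ↥(D i) = (ds i : WithBot ℕ∞))
    (hx : IsGoodSOP R M D ds x) (i : Fin (t + 1)) (n : ℕ) :
    Module.length R (Gr D i ⧸ (Ideal.span (Set.range x)) ^ (n + 1) • (⊤ : Submodule R (Gr D i))) =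
      F (seg ds x i) (⊥ : Submodule R (Gr D i)) n :=
  len_F _ (span_split x (ds i)) ((good_ann hd hD hds hx i).trans (ann_quot _)) n

lemma gr_fin (hx : IsGoodSOP R M D ds x) (i : Fin (t + 1)) (n : ℕ) :
    IsFiniteLength R
      (Gr D i ⧸ (Ideal.span (Set.range x)) ^ (n + 1) • (⊤ : Submodule R (Gr D i))) :=
  fl_of_sop (sop_dimLE hx.1.2) ((ann_sub (D i)).trans (ann_quot _)) n

lemma length_zero (I : Ideal R) : Module.length R (D 0 ⧸ I • (⊤ : Submodule R (D 0))) =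
    Module.length R (Gr D 0 ⧸ I • (⊤ : Submodule R (Gr D 0))) := by
  refine length_congr (Submodule.quotEquivOfEqBot _ ?_).symm I
  rw [predD_zero, Submodule.comap_bot, Submodule.ker_subtype]

lemma length_last (hD : IsDimFiltration R M D) (I : Ideal R) :
    Module.length R (D (Fin.last t) ⧸ I • (⊤ : Submodule R (D (Fin.last t)))) =
    Module.length R (M ⧸ I • (⊤ : Submodule R M)) :=
  length_congr (LinearEquiv.ofTop _ hD.2.1) I

/-- Length formula of the statement, in `ℕ∞`. -/
def Formula (D : Fin (t + 1) → Submodule R M) (ds : Fin (t + 1) → ℕ) (x : Fin d → R)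
    (n : ℕ) : Prop :=
  Module.length R (M ⧸ (Ideal.span (Set.range x)) ^ (n + 1) • (⊤ : Submodule R M)) =
    ∑ i : Fin (t + 1), ((n + ds i).choose (ds i) : ℕ∞) *
      Module.length R (Gr D i ⧸ (Ideal.span (Set.range x)) • (⊤ : Submodule R (Gr D i)))

theorem cm_formula (hd : moduleDim R M = (d : WithBot ℕ∞)) (hD : IsDimFiltration R M D)
    (hds : ∀ i, (D i = ⊥ ∧ ds i = 0) ∨ moduleDim R ↥(D i) = (ds i : WithBot ℕ∞))
    (hx : IsGoodSOP R M D ds x)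
    (hcm : ∀ i : Fin t, IsCM R (↥(D i.succ) ⧸ (D i.castSucc).comap (D i.succ).subtype)) (n : ℕ) :
    Formula D ds x n := by
  have hreg : ∀ i, RegOn (seg ds x i) (⊥ : Submodule R (Gr D i)) := by
    intro i
    induction i using Fin.cases with
    | zero =>
      have : seg ds x 0 = [] := by simp [seg, ds_zero hD hds]
      rw [this]; trivial
    | succ i =>
      have h1 := dim_quot ((D i.castSucc).comap (D i.succ).subtype) (ds_succ hD hds i) (by
        rw [moduleDim_congr (Submodule.comapSubtypeEquivOfLe (hD.2.2 i).1)]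
        exact (hD.2.2 i).2.1)
      have h2 := isCM_P h1 (hcm i)
      rw [← predD_succ D i] at h2
      refine sop_regOn _ (seg_mem hx.1.1 _) _ ?_ ?_
      · rw [seg_length (ds_le hd hds _)]; exact h2
      · rw [bot_sup_eq]
        have h3 := gr_fin hx i.succ 0
        rw [zero_add, span_split x (ds i.succ), smul_sup_ann
          ((good_ann hd hD hds hx i.succ).trans (ann_quot _)), pow_one] at h3
        exact exists_pow_of_fl_quot h3
  have ha : ∀ i, Module.length R (Gr D i ⧸ (Ideal.span (Set.range x)) ^ (n + 1) •
      (⊤ : Submodule R (Gr D i))) = ((n + ds i).choose (ds i) : ℕ∞) *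
      Module.length R (Gr D i ⧸ (Ideal.span (Set.range x)) • (⊤ : Submodule R (Gr D i))) := by
    intro i
    have h0 := gr_F hd hD hds hx i 0
    rw [zero_add, pow_one] at h0
    rw [gr_F hd hD hds hx, F_eq _ _ (hreg i), seg_length (ds_le hd hds _), h0]
  unfold Formula
  rw [← length_last hD, Finset.sum_congr rfl (fun i _ => (ha i).symm)]
  refine sum_eq (fun i => Module.length R (D i ⧸ (Ideal.span (Set.range x)) ^ (n + 1) •
    (⊤ : Submodule R (D i)))) _ (length_zero _) ?_
  intro i
  have h1 : RegOn (seg ds x i.succ) ((D i.castSucc).comap (D i.succ).subtype) := by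
    have := hreg i.succ
    rw [regOn_bot_iff] at this
    rw [regOn_iff, ← predD_succ D i]
    exact this
  have h2 := filt_eq (hD.2.2 i).1 (good_ann hd hD hds hx i.succ) (n + 1)
    (T_lemma _ _ h1 (n + 1))
  unfold seg at h2
  rw [← span_split] at h2
  exact h2

theorem formula_cm (hd : moduleDim R M = (d : WithBot ℕ∞)) (hD : IsDimFiltration R M D)
    (hds : ∀ i, (D i = ⊥ ∧ ds i = 0) ∨ moduleDim R ↥(D i) = (ds i : WithBot ℕ∞))
    (hx : IsGoodSOP R M D ds x) (hf : ∀ n, Formula D ds x n) (i : Fin t) :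
    IsCM R (↥(D i.succ) ⧸ (D i.castSucc).comap (D i.succ).subtype) := by
  have hb : ∀ i, Module.length R (Gr D i ⧸ (Ideal.span (Set.range x)) •
      (⊤ : Submodule R (Gr D i))) = F (seg ds x i) (⊥ : Submodule R (Gr D i)) 0 := by
    intro i
    have h0 := gr_F hd hD hds hx i 0
    rwa [zero_add, pow_one] at h0
  have hfin : ∀ i n, F (seg ds x i) (⊥ : Submodule R (Gr D i)) n ≠ ⊤ := by
    intro i n
    rw [← gr_F hd hD hds hx, Module.length_ne_top_iff]
    exact gr_fin hx i n
  have key : ∀ n i, F (seg ds x i) (⊥ : Submodule R (Gr D i)) n =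
      ((n + (seg ds x i).length).choose (seg ds x i).length : ℕ) *
        F (seg ds x i) (⊥ : Submodule R (Gr D i)) 0 := by
    intro n
    apply termwise
    · intro i
      exact WithTop.mul_ne_top (ENat.natCast_ne_top _) (hfin i 0)
    · intro i
      exact F_le _ _ _
    · have h1 := hf n
      unfold Formula at h1
      have h2 : ∀ i, ((n + (seg ds x i).length).choose (seg ds x i).length : ℕ∞) *
          F (seg ds x i) (⊥ : Submodule R (Gr D i)) 0 = ((n + ds i).choose (ds i) : ℕ∞) *
      Module.length R (Gr D i ⧸ (Ideal.span (Set.range x)) • (⊤ : Submodule R (Gr D i))) := by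
        intro i
        rw [seg_length (ds_le hd hds _), hb]
      rw [Finset.sum_congr rfl (fun i _ => h2 i), ← h1, ← length_last hD,
        Finset.sum_congr rfl (fun i _ => (gr_F hd hD hds hx i n).symm)]
      refine sum_le (fun i => Module.length R (D i ⧸ (Ideal.span (Set.range x)) ^ (n + 1) •
        (⊤ : Submodule R (D i)))) _ (length_zero _).le ?_
      intro i
      have h2 := filt_le (hD.2.2 i).1 ((Ideal.span (Set.range x)) ^ (n + 1))
      exact h2
  have hreg := regOn_of_F _ (seg_mem hx.1.1 i.succ) (⊥ : Submodule R (Gr D i.succ))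
    (hfin _ 0) (fun n => key n i.succ)
  have hnt : Nontrivial (↥(D i.succ) ⧸ (D i.castSucc).comap (D i.succ).subtype) := by
    rw [Submodule.Quotient.nontrivial_iff]
    intro h
    rw [Submodule.comap_subtype_eq_top] at h
    have := (hD.2.2 i).2.1
    rw [le_antisymm (hD.2.2 i).1 h] at this
    exact lt_irrefl _ this
  unfold Gr at hreg
  rw [predD_succ] at hreg
  refine isCM_of_regOn (seg ds x i.succ) (seg_mem hx.1.1 i.succ) ?_ hreg
  rw [seg_length (ds_le hd hds _), ← ds_succ hD hds i, moduleDim_eq, moduleDim_eq]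
  exact Module.supportDim_le_of_surjective (Submodule.mkQ _) (Submodule.mkQ_surjective _)

end main

end SCM

set_option linter.unusedSectionVars false

namespace SCM

open IsLocalRing

variable {R : Type*} [CommRing R] [IsLocalRing R] [IsNoetherianRing R]
  {M : Type*} [AddCommGroup M] [Module R M] [Module.Finite R M]

/-- Choosing one parameter. -/
lemma exists_param (I A : Ideal R) (j : ℕ) (hI : DimLE I (j + 1 : ℕ))
    (hA : ∀ p : PrimeSpectrum R, I ≤ p.asIdeal → Order.coheight p = (j + 1 : ℕ) →
      ¬ A ≤ p.asIdeal) :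
    ∃ y ∈ A, DimLE (I ⊔ Ideal.span {y}) j := by
  by_contra! hcon
  let S : Set (Ideal R) := {p | ∃ h : p.IsPrime, I ≤ p ∧
    Order.coheight (⟨p, h⟩ : PrimeSpectrum R) = (j + 1 : ℕ)}
  have hS : S.Finite := by
    refine (Ideal.finite_minimalPrimes_of_isNoetherianRing R I).subset ?_
    rintro p ⟨hp, hIp, hc⟩
    obtain ⟨p0, hp0, hle⟩ := Ideal.exists_minimalPrimes_le hIp
    rcases eq_or_lt_of_le hle with h | h
    · rwa [← h]
    · exfalso
      have h1 : (⟨p0, hp0.1.1⟩ : PrimeSpectrum R) < ⟨p, hp⟩ := h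
      have h2 := Order.coheight_add_one_le h1
      have h3 := h2.trans (hI _ hp0.1.2)
      rw [hc] at h3
      have : j + 1 + 1 ≤ j + 1 := by exact_mod_cast h3
      omega
  have hsub : (A : Set R) ⊆ ⋃ p ∈ S, (p : Set R) := by
    intro y hy
    have h1 := hcon y hy
    unfold DimLE at h1
    push Not at h1
    obtain ⟨p, hp, hc⟩ := h1
    have hIp : I ≤ p.asIdeal := le_sup_left.trans hp
    have hyp : y ∈ p.asIdeal := hp (Ideal.mem_sup_right (Ideal.mem_span_singleton_self y))
    refine Set.mem_biUnion (x := p.asIdeal) ⟨p.2, hIp, le_antisymm (hI p hIp) ?_⟩ hyp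
    push_cast
    exact Order.add_one_le_of_lt hc
  obtain ⟨p, ⟨hp, hIp, hc⟩, hle⟩ :=
    (Ideal.subset_union_prime_finite hS (f := id) ⊥ ⊥ (fun p hp _ _ => hp.choose)).1 hsub
  exact hA ⟨p, hp⟩ hIp hc hle

variable {d t : ℕ} {D : Fin (t + 1) → Submodule R M} {ds : Fin (t + 1) → ℕ}

lemma exists_seq (hd : moduleDim R M = (d : WithBot ℕ∞))
    (hds : ∀ i, (D i = ⊥ ∧ ds i = 0) ∨ moduleDim R ↥(D i) = (ds i : WithBot ℕ∞)) :
    ∀ m j : ℕ, j + m = d → ∃ x : ℕ → R,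
      (∀ k, j ≤ k → k < d → x k ∈ maximalIdeal R ∧
        ∀ i, ds i ≤ k → x k ∈ Module.annihilator R (D i)) ∧
      DimLE (Module.annihilator R M ⊔ Ideal.span {r | ∃ k, j ≤ k ∧ k < d ∧ r = x k}) j := by
  intro m
  induction m with
  | zero =>
    intro j hj
    refine ⟨0, fun k h1 h2 => by omega, dimLE_mono le_sup_left ?_⟩
    rw [dimLE_iff]
    have hj' : j = d := by omega
    rw [hj']
    exact hd.le
  | succ m ih =>
    intro j hj
    obtain ⟨x, hx, hdim⟩ := ih (j + 1) (by omega)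
    obtain ⟨y, hy, hydim⟩ := exists_param _ (maximalIdeal R ⊓
      (Finset.univ.filter (fun i => ds i ≤ j)).inf (fun i => Module.annihilator R (D i))) j hdim
      (by
        intro p _ hc hle
        rw [p.2.inf_le] at hle
        rcases hle with h | h
        · rw [coheight_max p h] at hc
          exact absurd hc (by exact_mod_cast (Nat.succ_ne_zero j).symm)
        · rw [p.2.inf_le'] at h
          obtain ⟨i, hi, hip⟩ := h
          have hi' : ds i ≤ j := (Finset.mem_filter.1 hi).2
          rcases hds i with ⟨hb, -⟩ | hi2
          · have : Subsingleton (D i) := by rw [hb]; infer_instance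
            rw [Module.annihilator_eq_top_iff.2 this] at hip
            exact p.2.ne_top (top_le_iff.1 hip)
          · have h3 : p ∈ Module.support R (D i) := by
              rw [Module.support_eq_zeroLocus]; exact hip
            have h4 := coheight_le_dim h3
            rw [hi2, hc] at h4
            have : j + 1 ≤ ds i := by exact_mod_cast h4
            omega)
    refine ⟨Function.update x j y, ?_, ?_⟩
    · intro k hk1 hk2
      by_cases hkj : k = j
      · subst hkj
        rw [Function.update_self]
        refine ⟨hy.1, fun i hi => ?_⟩
        have := (Finset.inf_le (f := fun i => Module.annihilator R (D i))
          (Finset.mem_filter.2 ⟨Finset.mem_univ i, hi⟩)) hy.2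
        exact this
      · rw [Function.update_of_ne hkj]
        exact hx k (by omega) hk2
    · refine dimLE_mono ?_ hydim
      refine sup_le (sup_le le_sup_left (le_trans ?_ le_sup_right)) (le_trans ?_ le_sup_right)
      · refine Ideal.span_mono ?_
        rintro r ⟨k, h1, h2, rfl⟩
        exact ⟨k, by omega, h2, by rw [Function.update_of_ne (by omega)]⟩
      · rw [Ideal.span_singleton_le_iff_mem]
        exact Ideal.subset_span ⟨j, le_rfl, by omega, by rw [Function.update_self]⟩

/-- If `J` annihilates `E` then `J^n M ∩ E = 0` for large `n`. -/
lemma artin_rees (E : Submodule R M) (J : Ideal R) (hJ : J ≤ Module.annihilator R E) :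
    ∃ c : ℕ, ∀ n, c ≤ n → E ⊓ J ^ n • (⊤ : Submodule R M) = ⊥ := by
  obtain ⟨c, hc⟩ := Ideal.exists_pow_inf_eq_pow_smul J E
  refine ⟨c + 1, fun n hn => ?_⟩
  rw [inf_comm, hc n (by omega), eq_bot_iff]
  have h1 : J ^ (n - c) ≤ J := Ideal.pow_le_self (by omega)
  refine (Submodule.smul_mono h1 inf_le_right).trans ?_
  rw [Submodule.smul_le]
  intro r hr m hm
  have := Module.mem_annihilator.1 (hJ hr) ⟨m, hm⟩
  rw [Submodule.mem_bot]
  exact congrArg Subtype.val this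

theorem exists_good (hd : moduleDim R M = (d : WithBot ℕ∞))
    (hds : ∀ i, (D i = ⊥ ∧ ds i = 0) ∨ moduleDim R ↥(D i) = (ds i : WithBot ℕ∞)) :
    ∃ x : Fin d → R, IsGoodSOP R M D ds x := by
  obtain ⟨x, hx, hdim⟩ := exists_seq (D := D) hd hds d 0 (by omega)
  have hJ : ∀ i, ∃ c : ℕ, ∀ n, c ≤ n → D i ⊓ (Ideal.span {r : R | ∃ j : Fin d,
      ds i ≤ (j : ℕ) ∧ r = x j}) ^ n • (⊤ : Submodule R M) = ⊥ := by
    intro i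
    apply artin_rees
    rw [Ideal.span_le]
    rintro r ⟨j, hj, rfl⟩
    exact (hx j (Nat.zero_le _) j.2).2 i hj
  choose c hc using hJ
  let n := Finset.univ.sup c + 1
  have hn : ∀ i, c i ≤ n := fun i =>
    (Finset.le_sup (f := c) (Finset.mem_univ i)).trans (Nat.le_succ _)
  refine ⟨fun j => x j ^ n, ⟨fun j => ?_, ?_⟩, fun i _ => ?_⟩
  · exact Ideal.pow_mem_of_mem _ (hx j (Nat.zero_le _) j.2).1 n (Nat.succ_pos _)
  · have h1 : DimLE (Module.annihilator R M ⊔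
        Ideal.span (Set.range fun j : Fin d => x j ^ n)) 0 := by
      intro p hp
      refine le_trans (hdim p (sup_le (le_sup_left.trans hp) (Ideal.span_le.2 ?_))) (by simp)
      rintro r ⟨k, -, hk, rfl⟩
      exact p.2.mem_of_pow_mem n
        (hp (Ideal.mem_sup_right (Ideal.subset_span ⟨⟨k, hk⟩, rfl⟩)))
    have h2 := fl_of_sop (N := M) h1 le_rfl 0
    rwa [zero_add, pow_one] at h2
  · rw [eq_bot_iff, ← hc i n (hn i)]
    refine inf_le_inf_left _ (Submodule.smul_mono_left (Ideal.span_le.2 ?_))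
    rintro r ⟨j, hj, rfl⟩
    have hmem : x j ∈ Ideal.span {r : R | ∃ j : Fin d, ds i ≤ (j : ℕ) ∧ r = x j} :=
      Ideal.subset_span ⟨j, hj, rfl⟩
    exact Ideal.pow_mem_pow hmem n

/-- The formula in `WithBot ℕ∞`. -/
lemma formula_iff (x : Fin d → R) (n : ℕ) :
    (moduleLength R (M ⧸ ((Ideal.span (Set.range x)) ^ (n + 1) • (⊤ : Submodule R M))) =
      ∑ i : Fin (t + 1), ((n + ds i).choose (ds i) : WithBot ℕ∞) *
        moduleLength R ((↥(D i) ⧸ (predD D i).comap (D i).subtype) ⧸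
          (Ideal.span (Set.range x) •
            (⊤ : Submodule R (↥(D i) ⧸ (predD D i).comap (D i).subtype))))) ↔
    Formula D ds x n := by
  simp only [moduleLength_eq]
  unfold Formula
  norm_cast

end SCM

/-- **Theorem 4.3.** With `𝒟_0 = D_0` and `𝒟_i = D_i/D_{i-1}`, `M` is sequentially
Cohen-Macaulay iff for every (equivalently, some) good parameter ideal `q` of `M` one has
`ℓ(M/q^{n+1}M) = Σ_{i=0}^{t} C(n+d_i, d_i)·ℓ(𝒟_i/q𝒟_i)` for all `n ≥ 0`. -/
theorem stmt_19 {R : Type*} [CommRing R] [IsLocalRing R] [IsNoetherianRing R]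
    {M : Type*} [AddCommGroup M] [Module R M] [Module.Finite R M]
    {d t : ℕ} (hd : moduleDim R M = (d : WithBot ℕ∞))
    (D : Fin (t + 1) → Submodule R M) (hD : IsDimFiltration R M D)
    (ds : Fin (t + 1) → ℕ)
    (hds : ∀ i, (D i = ⊥ ∧ ds i = 0) ∨ moduleDim R ↥(D i) = (ds i : WithBot ℕ∞)) :
    List.TFAE
      [∀ i : Fin t, IsCM R (↥(D i.succ) ⧸ (D i.castSucc).comap (D i.succ).subtype),
       ∀ x : Fin d → R, IsGoodSOP R M D ds x → ∀ n : ℕ,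
         moduleLength R
             (M ⧸ ((Ideal.span (Set.range x)) ^ (n + 1) • (⊤ : Submodule R M))) =
           ∑ i : Fin (t + 1), ((n + ds i).choose (ds i) : WithBot ℕ∞) *
             moduleLength R
               ((↥(D i) ⧸ (predD D i).comap (D i).subtype) ⧸
                 (Ideal.span (Set.range x) •
                   (⊤ : Submodule R (↥(D i) ⧸ (predD D i).comap (D i).subtype)))),
       ∃ x : Fin d → R, IsGoodSOP R M D ds x ∧ ∀ n : ℕ,
         moduleLength R
             (M ⧸ ((Ideal.span (Set.range x)) ^ (n + 1) • (⊤ : Submodule R M))) =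
           ∑ i : Fin (t + 1), ((n + ds i).choose (ds i) : WithBot ℕ∞) *
             moduleLength R
               ((↥(D i) ⧸ (predD D i).comap (D i).subtype) ⧸
                 (Ideal.span (Set.range x) •
                   (⊤ : Submodule R (↥(D i) ⧸ (predD D i).comap (D i).subtype))))] := by
  tfae_have 1 → 2 := fun h x hx n => (SCM.formula_iff x n).2 (SCM.cm_formula hd hD hds hx h n)
  tfae_have 2 → 3 := by
    intro h
    obtain ⟨x, hx⟩ := SCM.exists_good (D := D) hd hds
    exact ⟨x, hx, h x hx⟩
  tfae_have 3 → 1 := by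
    rintro ⟨x, hx, hf⟩ i
    exact SCM.formula_cm hd hD hds hx (fun n => (SCM.formula_iff x n).1 (hf n)) i
  tfae_finish
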